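/- arXiv:2412.11244 — 4 statements merged into one kernel-verified Lean document; each statement's English description precedes it below -/
import Mathlib

section
/- Suppose a non-elementary group G acts geometrically (properly and cocompactly) by isometries on a proper geodesic metric space (X,d) that is a Morse local-to-global space and contains a Morse geodesic ray. If H < G is a stable subgroup of infinite index, then the growth rates satisfy ω(H) < ω(G). -/
open Metric Set Filter Pointwise

/-- `γ` restricted to `[0, L]` is a `(lam, c)`-quasi-geodesic parametrized by arc length:
the length of the subpath from `s` to `t` is `t - s`. -/
def IsQuasiGeodesicOn {X : Type*} [MetricSpace X] (γ : ℝ → X) (L lam c : ℝ) : Prop :=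
  (∀ s t : ℝ, 0 ≤ s → s ≤ t → t ≤ L → dist (γ s) (γ t) ≤ t - s) ∧
  (∀ s t : ℝ, 0 ≤ s → s ≤ t → t ≤ L → t - s ≤ lam * dist (γ s) (γ t) + c)

/-- `γ` restricted to `[0, L]` is a geodesic (unit speed). -/
def IsGeodesicOn {X : Type*} [MetricSpace X] (γ : ℝ → X) (L : ℝ) : Prop :=
  ∀ s t : ℝ, s ∈ Set.Icc 0 L → t ∈ Set.Icc 0 L → dist (γ s) (γ t) = |s - t|

/-- A metric space is geodesic if any two points are joined by a geodesic. -/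
def GeodesicSpace (X : Type*) [MetricSpace X] : Prop :=
  ∀ x y : X, ∃ γ : ℝ → X, γ 0 = x ∧ γ (dist x y) = y ∧ IsGeodesicOn γ (dist x y)

/-- The path `γ` on `[0, L]` is `M`-Morse: every `(lam, c)`-quasi-geodesic with endpoints
on `γ` stays within distance `M lam c` of the corresponding subpath of `γ`. -/
def IsMorseOn {X : Type*} [MetricSpace X] (γ : ℝ → X) (L : ℝ) (M : ℝ → ℝ → ℝ) : Prop :=
  ∀ lam c : ℝ, 1 ≤ lam → 0 ≤ c →
    ∀ (β : ℝ → X) (Lβ : ℝ), 0 ≤ Lβ → IsQuasiGeodesicOn β Lβ lam c →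
      ∀ s t : ℝ, 0 ≤ s → s ≤ t → t ≤ L → β 0 = γ s → β Lβ = γ t →
        ∀ u ∈ Set.Icc (0:ℝ) Lβ, ∃ v ∈ Set.Icc s t, dist (β u) (γ v) ≤ M lam c

/-- `γ` on `[0, Lγ]` is an `(L; M; lam, c)`-local Morse quasi-geodesic: every subpath of
length at most `L` is an `(M; lam, c)`-Morse quasi-geodesic. -/
def LocalMorseQuasiGeodesicOn {X : Type*} [MetricSpace X] (γ : ℝ → X) (Lγ L : ℝ)
    (M : ℝ → ℝ → ℝ) (lam c : ℝ) : Prop :=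
  ∀ s t : ℝ, 0 ≤ s → s ≤ t → t ≤ Lγ → t - s ≤ L →
    IsQuasiGeodesicOn (fun u => γ (s + u)) (t - s) lam c ∧
    IsMorseOn (fun u => γ (s + u)) (t - s) M

/-- Morse local-to-global space. -/
def MorseLocalToGlobalSpace (X : Type*) [MetricSpace X] : Prop :=
  ∀ (M : ℝ → ℝ → ℝ) (lam c : ℝ), 1 ≤ lam → 0 ≤ c →
    ∃ (M' : ℝ → ℝ → ℝ) (L lam' c' : ℝ), 0 ≤ L ∧ 1 ≤ lam' ∧ 0 ≤ c' ∧
      ∀ (γ : ℝ → X) (Lγ : ℝ), 0 ≤ Lγ → LocalMorseQuasiGeodesicOn γ Lγ L M lam c →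
        IsQuasiGeodesicOn γ Lγ lam' c' ∧ IsMorseOn γ Lγ M'

/-- A Morse geodesic ray: an isometric embedding of `[0, ∞)` which is `M`-Morse. -/
def IsMorseGeodesicRay {X : Type*} [MetricSpace X] (γ : ℝ → X) (M : ℝ → ℝ → ℝ) : Prop :=
  (∀ s t : ℝ, 0 ≤ s → 0 ≤ t → dist (γ s) (γ t) = |s - t|) ∧
  (∀ lam c : ℝ, 1 ≤ lam → 0 ≤ c →
    ∀ (β : ℝ → X) (Lβ : ℝ), 0 ≤ Lβ → IsQuasiGeodesicOn β Lβ lam c →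
      ∀ s t : ℝ, 0 ≤ s → s ≤ t → β 0 = γ s → β Lβ = γ t →
        ∀ u ∈ Set.Icc (0:ℝ) Lβ, ∃ v ∈ Set.Icc s t, dist (β u) (γ v) ≤ M lam c)

/-- The action of `G` on `X` is by isometries. -/
def IsometricAction (G X : Type*) [Group G] [MetricSpace X] [MulAction G X] : Prop :=
  ∀ (g : G) (x y : X), dist (g • x) (g • y) = dist x y

/-- The action of `G` on `X` is (metrically) proper. -/
def ProperAction (G X : Type*) [Group G] [MetricSpace X] [MulAction G X] : Prop :=
  ∀ (x : X) (r : ℝ), 0 < r → {g : G | dist x (g • x) ≤ r}.Finite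

/-- The action of `G` on `X` is cocompact. -/
def CocompactAction (G X : Type*) [Group G] [MetricSpace X] [MulAction G X] : Prop :=
  ∃ K : Set X, IsCompact K ∧ ∀ x : X, ∃ g : G, g • x ∈ K

/-- `H` is a stable subgroup: there are a Morse gauge `M` and `D ≥ 0` such that every
geodesic `[o, h • o]` is `M`-Morse and contained in the `D`-neighborhood of `H • o`. -/
def IsStableSubgroup {X G : Type*} [MetricSpace X] [Group G] [MulAction G X]
    (o : X) (H : Subgroup G) : Prop :=
  ∃ (M : ℝ → ℝ → ℝ) (D : ℝ), 0 ≤ D ∧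
    ∀ h ∈ H, ∀ γ : ℝ → X, γ 0 = o → γ (dist o (h • o)) = h • o →
      IsGeodesicOn γ (dist o (h • o)) →
      IsMorseOn γ (dist o (h • o)) M ∧
      ∀ s ∈ Set.Icc 0 (dist o (h • o)), ∃ h' ∈ H, dist (γ s) (h' • o) ≤ D

/-- A Morse element: an infinite order element generating a stable cyclic subgroup. -/
def IsMorseElement {X G : Type*} [MetricSpace X] [Group G] [MulAction G X]
    (o : X) (g : G) : Prop :=
  ¬ IsOfFinOrder g ∧ IsStableSubgroup o (Subgroup.zpowers g)

/-- `H` is quasi-convex: geodesics with endpoints on `H • o` stay in a `σ`-neighborhood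
of `H • o`. -/
def IsQuasiConvexSubgroup {X G : Type*} [MetricSpace X] [Group G] [MulAction G X]
    (o : X) (H : Subgroup G) : Prop :=
  ∃ σ : ℝ, 0 ≤ σ ∧ ∀ h h' : G, h ∈ H → h' ∈ H →
    ∀ γ : ℝ → X, γ 0 = h • o → γ (dist (h • o) (h' • o)) = h' • o →
      IsGeodesicOn γ (dist (h • o) (h' • o)) →
      ∀ s ∈ Set.Icc 0 (dist (h • o) (h' • o)), ∃ h'' ∈ H, dist (γ s) (h'' • o) ≤ σ

/-- The growth rate `ω(A) = limsup (log #(B(n) ∩ A)) / n` of a subset `A ⊆ G`. -/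
noncomputable def growthRate {X G : Type*} [MetricSpace X] [Group G] [MulAction G X]
    (o : X) (A : Set G) : ℝ :=
  Filter.limsup (fun n : ℕ =>
    Real.log ((A ∩ {g : G | dist o (g • o) ≤ (n : ℝ)}).ncard) / (n : ℝ)) Filter.atTop

/-- Convergence of the Poincaré series `𝒫_A(s) = Σ_{g ∈ A} exp (-s · d_G(1, g))`. -/
def PoincareSummable {X G : Type*} [MetricSpace X] [Group G] [MulAction G X]
    (o : X) (A : Set G) (s : ℝ) : Prop :=
  Summable fun g : A => Real.exp (-s * dist o ((g : G) • o))

/-- A group is virtually cyclic if it has a cyclic subgroup of finite index. -/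
def VirtuallyCyclic (G : Type*) [Group G] : Prop :=
  ∃ H : Subgroup G, IsCyclic H ∧ H.FiniteIndex

/-- The annulus set `𝒜(n, Δ) = {h ∈ H : |d_G(1,h) - n| ≤ Δ}`. -/
def annulus {X G : Type*} [MetricSpace X] [Group G] [MulAction G X]
    (o : X) (H : Subgroup G) (n Δ : ℝ) : Set G :=
  {h : G | h ∈ H ∧ |dist o (h • o) - n| ≤ Δ}

/-- Evaluation of a formal alternating word `a₁b₁a₂b₂⋯aₙbₙ` in `G`. -/
def evalWord {G : Type*} [Group G] (w : List (G × G)) : G :=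
  (w.map fun p => p.1 * p.2).prod

/-- The set `𝕎(A, B)` of (nonempty) formal alternating words with letters in `A` and `B`. -/
def AltWords {G : Type*} [Group G] (A B : Set G) : Set (List (G × G)) :=
  {w | w ≠ [] ∧ ∀ p ∈ w, p.1 ∈ A ∧ p.2 ∈ B}

/-- The nearest-point projection `π_A(x)` of a point to a subset `A ⊆ X`. -/
def projSet {X : Type*} [MetricSpace X] (A : Set X) (x : X) : Set X :=
  {a ∈ A | dist x a = Metric.infDist x A}

/-- The projection `π_A(Y) = ⋃_{y ∈ Y} π_A(y)` of a subset `Y` to `A`. -/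
def projSetOf {X : Type*} [MetricSpace X] (A Y : Set X) : Set X :=
  ⋃ y ∈ Y, projSet A y

section PathGeometry

variable {X : Type*} [MetricSpace X]

/-- `γ` is a `(lam, c)`-quasi-geodesic on the interval `[a, b]`. -/
def QGOn (γ : ℝ → X) (a b lam c : ℝ) : Prop :=
  (∀ s t : ℝ, a ≤ s → s ≤ t → t ≤ b → dist (γ s) (γ t) ≤ t - s) ∧
  (∀ s t : ℝ, a ≤ s → s ≤ t → t ≤ b → t - s ≤ lam * dist (γ s) (γ t) + c)

/-- `γ` is `M`-Morse on the interval `[a, b]`. -/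
def MorseBetween (γ : ℝ → X) (a b : ℝ) (M : ℝ → ℝ → ℝ) : Prop :=
  ∀ lam c : ℝ, 1 ≤ lam → 0 ≤ c → ∀ (β : ℝ → X) (p q : ℝ), p ≤ q → QGOn β p q lam c →
    ∀ s t : ℝ, a ≤ s → s ≤ t → t ≤ b → β p = γ s → β q = γ t →
      ∀ u ∈ Icc p q, ∃ v ∈ Icc s t, dist (β u) (γ v) ≤ M lam c

/-- `γ` is a unit speed geodesic on the interval `[a, b]`. -/
def GeodOn (γ : ℝ → X) (a b : ℝ) : Prop :=
  ∀ s t : ℝ, a ≤ s → s ≤ t → t ≤ b → dist (γ s) (γ t) = t - s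

theorem GeodOn.qgOn {γ : ℝ → X} {a b : ℝ} (h : GeodOn γ a b) : QGOn γ a b 1 0 :=
  ⟨fun s t h1 h2 h3 => (h s t h1 h2 h3).le, fun s t h1 h2 h3 => by rw [h s t h1 h2 h3]; simp⟩

theorem GeodOn.sub {γ : ℝ → X} {a b a' b' : ℝ} (h : GeodOn γ a b) (ha : a ≤ a') (hb : b' ≤ b) :
    GeodOn γ a' b' :=
  fun s t h1 h2 h3 => h s t (ha.trans h1) h2 (h3.trans hb)

theorem GeodOn.neg {γ : ℝ → X} {a b : ℝ} (h : GeodOn γ a b) :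
    GeodOn (fun t => γ (-t)) (-b) (-a) := fun s t h1 h2 h3 => by
  have := h (-t) (-s) (by linarith) (by linarith) (by linarith)
  simp only [dist_comm (γ (-s)), this]; ring

theorem QGOn.mono {γ : ℝ → X} {a b lam c lam' c' : ℝ} (h : QGOn γ a b lam c) (hl : lam ≤ lam')
    (hc : c ≤ c') : QGOn γ a b lam' c' :=
  ⟨h.1, fun s t h1 h2 h3 => (h.2 s t h1 h2 h3).trans <| by gcongr⟩

theorem QGOn.sub {γ : ℝ → X} {a b lam c a' b' : ℝ} (h : QGOn γ a b lam c) (ha : a ≤ a')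
    (hb : b' ≤ b) : QGOn γ a' b' lam c :=
  ⟨fun s t h1 h2 h3 => h.1 s t (ha.trans h1) h2 (h3.trans hb),
   fun s t h1 h2 h3 => h.2 s t (ha.trans h1) h2 (h3.trans hb)⟩

theorem QGOn.congr {γ γ' : ℝ → X} {a b lam c : ℝ} (h : QGOn γ a b lam c)
    (he : EqOn γ' γ (Icc a b)) : QGOn γ' a b lam c := by
  constructor <;> intro s t h1 h2 h3 <;>
    rw [he ⟨h1, h2.trans h3⟩, he ⟨h1.trans h2, h3⟩]
  · exact h.1 s t h1 h2 h3
  · exact h.2 s t h1 h2 h3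

theorem QGOn.neg {γ : ℝ → X} {a b lam c : ℝ} (h : QGOn γ a b lam c) :
    QGOn (fun t => γ (-t)) (-b) (-a) lam c := by
  constructor <;> intro s t h1 h2 h3
  · have := h.1 (-t) (-s) (by linarith) (by linarith) (by linarith)
    simp only [dist_comm (γ (-s))]; linarith
  · have := h.2 (-t) (-s) (by linarith) (by linarith) (by linarith)
    simp only [dist_comm (γ (-s))]; linarith

theorem QGOn.comp_add {γ : ℝ → X} {a b lam c : ℝ} (d : ℝ) (h : QGOn γ a b lam c) {a' b' : ℝ}
    (ha : a ≤ d + a') (hb : d + b' ≤ b) : QGOn (fun t => γ (d + t)) a' b' lam c := by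
  constructor <;> intro s t h1 h2 h3
  · have := h.1 (d + s) (d + t) (by linarith) (by linarith) (by linarith)
    linarith
  · have := h.2 (d + s) (d + t) (by linarith) (by linarith) (by linarith)
    linarith

theorem QGOn.continuousOn {γ : ℝ → X} {a b lam c : ℝ} (h : QGOn γ a b lam c) :
    ContinuousOn γ (Icc a b) := by
  refine (LipschitzOnWith.of_dist_le_mul (K := 1) fun s hs t ht => ?_).continuousOn
  rw [NNReal.coe_one, one_mul, Real.dist_eq]
  rcases le_total s t with hst | hst
  · rw [abs_sub_comm, abs_of_nonneg (by linarith)]; exact h.1 s t hs.1 hst ht.2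
  · rw [abs_of_nonneg (by linarith), dist_comm]; exact h.1 t s ht.1 hst hs.2

/-- A path that is `1`-Lipschitz and nearly as short as possible is a quasi-geodesic. -/
theorem qgOn_of_dist_endpoints {γ : ℝ → X} {a b K : ℝ}
    (h : ∀ s t : ℝ, a ≤ s → s ≤ t → t ≤ b → dist (γ s) (γ t) ≤ t - s)
    (hK : b - a ≤ dist (γ a) (γ b) + K) : QGOn γ a b 1 K := by
  refine ⟨h, fun s t h1 h2 h3 => ?_⟩
  have e1 := h a s le_rfl h1 (h2.trans h3)
  have e2 := h t b (h1.trans h2) h3 le_rfl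
  have := dist_triangle4 (γ a) (γ s) (γ t) (γ b)
  linarith

theorem lipschitz_glue {γ : ℝ → X} {a b c : ℝ}
    (h1 : ∀ s t : ℝ, a ≤ s → s ≤ t → t ≤ b → dist (γ s) (γ t) ≤ t - s)
    (h2 : ∀ s t : ℝ, b ≤ s → s ≤ t → t ≤ c → dist (γ s) (γ t) ≤ t - s) :
    ∀ s t : ℝ, a ≤ s → s ≤ t → t ≤ c → dist (γ s) (γ t) ≤ t - s := by
  intro s t hs hst ht
  rcases le_total t b with htb | htb
  · exact h1 s t hs hst htb
  rcases le_total s b with hsb | hsb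
  · have := dist_triangle (γ s) (γ b) (γ t)
    linarith [h1 s b hs hsb le_rfl, h2 b t le_rfl htb ht]
  · exact h2 s t hsb hst ht

theorem GeodesicSpace.exists_geodOn (hX : GeodesicSpace X) (x y : X) (a : ℝ) :
    ∃ γ : ℝ → X, γ a = x ∧ γ (a + dist x y) = y ∧ GeodOn γ a (a + dist x y) := by
  obtain ⟨γ, h0, h1, h2⟩ := hX x y
  refine ⟨fun t => γ (t - a), by simpa, by simpa, fun s t hs hst ht => ?_⟩
  rw [h2 _ _ ⟨by linarith, by linarith⟩ ⟨by linarith, by linarith⟩, abs_sub_comm,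
    abs_of_nonneg (by linarith)]
  ring

/-- Extending a quasi-geodesic by a geodesic to a point for which the endpoint is nearly the
closest point of the path. -/
theorem QGOn.extend (hX : GeodesicSpace X) {β : ℝ → X} {p q lam c D : ℝ}
    (hl : 1 ≤ lam) (h : QGOn β p q lam c) (hc : 0 ≤ c) (hD : 0 ≤ D) (x : X)
    (hx : ∀ s ∈ Icc p q, dist x (β q) ≤ dist x (β s) + D) :
    ∃ (β' : ℝ → X) (q' : ℝ), q ≤ q' ∧ EqOn β' β (Icc p q) ∧ β' q' = x ∧
      QGOn β' p q' (2 * lam + 1) (c + (lam + 1) * D) := by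
  obtain ⟨δ, d0, d1, d2⟩ := hX.exists_geodOn (β q) x q
  set ℓ := dist (β q) x with hℓ
  have hℓ0 : 0 ≤ ℓ := dist_nonneg
  set β' : ℝ → X := fun t => if t ≤ q then β t else δ t with hβ'
  have e1 : ∀ t, t ≤ q → β' t = β t := fun t ht => by simp [hβ', ht]
  have e2 : ∀ t, q ≤ t → β' t = δ t := fun t ht => by
    rcases ht.eq_or_lt with rfl | ht
    · rw [e1 _ le_rfl, d0]
    · simp [hβ', not_le.2 ht]
  have hE : 0 ≤ (lam + 1) * D := by positivity
  refine ⟨β', q + ℓ, by linarith, fun t ht => e1 t ht.2, by rw [e2 _ (by linarith), d1], ?_, ?_⟩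
  · refine lipschitz_glue (b := q) (fun s t h1 h2 h3 => ?_) (fun s t h1 h2 h3 => ?_)
    · rw [e1 s (h2.trans h3), e1 t h3]; exact h.1 s t h1 h2 h3
    · rw [e2 s h1, e2 t (h1.trans h2)]; exact (d2 s t h1 h2 h3).le
  · intro s t h1 h2 h3
    rcases le_total t q with htq | htq
    · rw [e1 s (h2.trans htq), e1 t htq]
      have := h.2 s t h1 h2 htq
      have h0 : 0 ≤ dist (β s) (β t) := dist_nonneg
      nlinarith
    rcases le_total q s with hqs | hqs
    · rw [e2 s hqs, e2 t htq, d2 s t hqs h2 h3]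
      nlinarith
    · rw [e1 s hqs, e2 t htq]
      have a1 := d2 q t le_rfl htq h3
      have a2 := d2 t (q + ℓ) htq h3 le_rfl
      rw [d0] at a1
      rw [d1] at a2
      have a3 := hx s ⟨h1, hqs⟩
      rw [dist_comm x (β q), ← hℓ] at a3
      have a4 := h.2 s q h1 hqs le_rfl
      have a5 := dist_triangle (β s) (δ t) x
      have a6 := dist_triangle (β s) (δ t) (β q)
      rw [dist_comm (δ t) (β q)] at a6
      rw [dist_comm x (β s)] at a3
      have a7 : t - q ≤ dist (β s) (δ t) + D := by linarith
      have a8 : lam * dist (β s) (β q) ≤ lam * (2 * dist (β s) (δ t) + D) := by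
        gcongr; linarith
      nlinarith

theorem QGOn.extend_left (hX : GeodesicSpace X) {β : ℝ → X} {p q lam c D : ℝ}
    (hl : 1 ≤ lam) (h : QGOn β p q lam c) (hc : 0 ≤ c) (hD : 0 ≤ D) (x : X)
    (hx : ∀ s ∈ Icc p q, dist x (β p) ≤ dist x (β s) + D) :
    ∃ (β' : ℝ → X) (p' : ℝ), p' ≤ p ∧ EqOn β' β (Icc p q) ∧ β' p' = x ∧
      QGOn β' p' q (2 * lam + 1) (c + (lam + 1) * D) := by
  obtain ⟨β', q', h1, h2, h3, h4⟩ := h.neg.extend hX hl hc hD x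
    (fun s hs => by simpa using hx (-s) ⟨by linarith [hs.2], by linarith [hs.1]⟩)
  refine ⟨fun t => β' (-t), -q', by linarith, fun t ht => ?_, by simpa, by simpa using h4.neg⟩
  have := h2 (x := -t) ⟨by linarith [ht.2], by linarith [ht.1]⟩
  simpa using this

theorem QGOn.extend_both (hX : GeodesicSpace X) {β : ℝ → X} {p q lam c C : ℝ} (hpq : p ≤ q)
    (hl : 1 ≤ lam) (h : QGOn β p q lam c) (hc : 0 ≤ c) (hC : 0 ≤ C) (x y : X)
    (hx : dist x (β p) ≤ C) (hy : dist y (β q) ≤ C) :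
    ∃ (β' : ℝ → X) (p' q' : ℝ), p' ≤ p ∧ q ≤ q' ∧ EqOn β' β (Icc p q) ∧ β' p' = x ∧ β' q' = y ∧
      QGOn β' p' q' (4 * lam + 3) (c + (3 * lam + 3) * C) := by
  obtain ⟨β₁, q', h1, h2, h3, h4⟩ := h.extend hX hl hc hC y
    (fun s _ => by linarith [dist_nonneg (x := y) (y := β s)])
  have hp : β₁ p = β p := h2 ⟨le_rfl, hpq⟩
  obtain ⟨β₂, p', h5, h6, h7, h8⟩ := h4.extend_left hX (by linarith)
    (by positivity) hC x
    (fun s _ => by rw [hp]; linarith [dist_nonneg (x := x) (y := β₁ s)])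
  refine ⟨β₂, p', q', h5, h1, fun t ht => ?_, h7, ?_, h8.mono (by linarith) (by linarith)⟩
  · rw [h6 ⟨ht.1, ht.2.trans h1⟩, h2 ht]
  · rw [h6 ⟨hpq.trans h1, le_rfl⟩, h3]

/-- Splitting a quasi-geodesic at a point closest to `x`, both halves extend to quasi-geodesics
ending at `x`. -/
theorem QGOn.exists_closest (hX : GeodesicSpace X) {β : ℝ → X} {p q lam c : ℝ} (hpq : p ≤ q)
    (hl : 1 ≤ lam) (h : QGOn β p q lam c) (hc : 0 ≤ c) (x : X) :
    ∃ u ∈ Icc p q, (∀ s ∈ Icc p q, dist x (β u) ≤ dist x (β s)) ∧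
      (∃ (β' : ℝ → X) (q' : ℝ), u ≤ q' ∧ EqOn β' β (Icc p u) ∧ β' q' = x ∧
        QGOn β' p q' (2 * lam + 1) c) ∧
      (∃ (β' : ℝ → X) (p' : ℝ), p' ≤ u ∧ EqOn β' β (Icc u q) ∧ β' p' = x ∧
        QGOn β' p' q (2 * lam + 1) c) := by
  obtain ⟨u, hu, hmin⟩ := isCompact_Icc.exists_isMinOn (nonempty_Icc.2 hpq)
    ((continuous_const (y := x).dist continuous_id).comp_continuousOn h.continuousOn)
  have hmin' : ∀ s ∈ Icc p q, dist x (β u) ≤ dist x (β s) := fun s hs => hmin hs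
  refine ⟨u, hu, hmin', ?_, ?_⟩
  · simpa using (h.sub le_rfl hu.2).extend hX hl hc le_rfl x
      (fun s hs => by simpa using hmin' s ⟨hs.1, hs.2.trans hu.2⟩)
  · simpa using (h.sub hu.1 le_rfl).extend_left hX hl hc le_rfl x
      (fun s hs => by simpa using hmin' s ⟨hu.1.trans hs.1, hs.2⟩)

theorem MorseBetween.sub {γ : ℝ → X} {a b a' b' : ℝ} {M : ℝ → ℝ → ℝ} (h : MorseBetween γ a b M)
    (ha : a ≤ a') (hb : b' ≤ b) : MorseBetween γ a' b' M :=
  fun lam c hl hc β p q hpq hβ s t hs hst ht =>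
    h lam c hl hc β p q hpq hβ s t (ha.trans hs) hst (ht.trans hb)

theorem MorseBetween.congr {γ γ' : ℝ → X} {a b : ℝ} {M : ℝ → ℝ → ℝ} (h : MorseBetween γ a b M)
    (he : EqOn γ' γ (Icc a b)) : MorseBetween γ' a b M := by
  intro lam c hl hc β p q hpq hβ s t hs hst ht hp hq u hu
  rw [he ⟨hs, hst.trans ht⟩] at hp
  rw [he ⟨hs.trans hst, ht⟩] at hq
  obtain ⟨v, hv, hd⟩ := h lam c hl hc β p q hpq hβ s t hs hst ht hp hq u hu
  exact ⟨v, hv, by rwa [he ⟨hs.trans hv.1, hv.2.trans ht⟩]⟩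

theorem MorseBetween.neg {γ : ℝ → X} {a b : ℝ} {M : ℝ → ℝ → ℝ} (h : MorseBetween γ a b M) :
    MorseBetween (fun t => γ (-t)) (-b) (-a) M := by
  intro lam c hl hc β p q hpq hβ s t hs hst ht hp hq u hu
  obtain ⟨v, hv, hd⟩ := h lam c hl hc (fun t => β (-t)) (-q) (-p) (by linarith) hβ.neg (-t) (-s)
    (by linarith) (by linarith) (by linarith) (by simpa) (by simpa) (-u)
    ⟨by linarith [hu.2], by linarith [hu.1]⟩
  exact ⟨-v, ⟨by linarith [hv.2], by linarith [hv.1]⟩, by simpa using hd⟩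

theorem MorseBetween.comp_add {γ : ℝ → X} {a b : ℝ} {M : ℝ → ℝ → ℝ} (d : ℝ)
    (h : MorseBetween γ a b M) {a' b' : ℝ} (ha : a ≤ d + a') (hb : d + b' ≤ b) :
    MorseBetween (fun t => γ (d + t)) a' b' M := by
  intro lam c hl hc β p q hpq hβ s t hs hst ht hp hq u hu
  obtain ⟨v, hv, hd⟩ := h lam c hl hc β p q hpq hβ (d + s) (d + t) (by linarith) (by linarith)
    (by linarith) hp hq u hu
  exact ⟨v - d, ⟨by linarith [hv.1], by linarith [hv.2]⟩, by simpa using hd⟩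

theorem isQuasiGeodesicOn_shift_iff {γ : ℝ → X} {s t lam c : ℝ} :
    IsQuasiGeodesicOn (fun u => γ (s + u)) (t - s) lam c ↔ QGOn γ s t lam c := by
  constructor
  · intro h
    have : QGOn (fun u => γ (s + u)) 0 (t - s) lam c := h
    simpa using this.comp_add (-s) (a' := s) (b' := t) (by simp) (by linarith)
  · intro h
    exact h.comp_add s (by simp) (by simp)

theorem isMorseOn_iff {γ : ℝ → X} {L : ℝ} {M : ℝ → ℝ → ℝ} :
    IsMorseOn γ L M ↔ MorseBetween γ 0 L M := by
  constructor
  · intro h lam c hl hc β p q hpq hβ s t hs hst ht hp hq u hu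
    obtain ⟨v, hv, hd⟩ := h lam c hl hc (fun u => β (p + u)) (q - p) (by linarith)
      (isQuasiGeodesicOn_shift_iff.2 hβ) s t hs hst ht (by simpa) (by simpa) (u - p)
      ⟨by linarith [hu.1], by linarith [hu.2]⟩
    exact ⟨v, hv, by simpa using hd⟩
  · intro h lam c hl hc β L hL hβ s t hs hst ht hp hq u hu
    exact h lam c hl hc β 0 L hL hβ s t hs hst ht hp hq u hu

theorem isMorseOn_shift_iff {γ : ℝ → X} {s t : ℝ} {M : ℝ → ℝ → ℝ} :
    IsMorseOn (fun u => γ (s + u)) (t - s) M ↔ MorseBetween γ s t M := by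
  rw [isMorseOn_iff]
  constructor
  · intro h
    simpa using h.comp_add (-s) (a' := s) (b' := t) (by simp) (by linarith)
  · intro h
    exact h.comp_add s (by simp) (by simp)

/-- A concatenation of two Morse paths is Morse. -/
theorem MorseBetween.glue (hX : GeodesicSpace X) {γ : ℝ → X} {a b c : ℝ} {M M' : ℝ → ℝ → ℝ}
    (h : MorseBetween γ a b M) (h' : MorseBetween γ b c M') :
    MorseBetween γ a c
      (fun lam e => max (M (2 * lam + 1) e) (M' (2 * lam + 1) e)) := by
  intro lam e hl he β p q hpq hβ s t hs hst ht hp hq u hu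
  have hβ' : QGOn β p q (2 * lam + 1) e := hβ.mono (by linarith) le_rfl
  rcases le_total t b with htb | htb
  · obtain ⟨v, hv, hd⟩ := h _ e (by linarith) he β p q hpq hβ' s t hs hst htb hp hq u hu
    exact ⟨v, hv, hd.trans (le_max_left _ _)⟩
  rcases le_total b s with hbs | hbs
  · obtain ⟨v, hv, hd⟩ := h' _ e (by linarith) he β p q hpq hβ' s t hbs hst ht hp hq u hu
    exact ⟨v, hv, hd.trans (le_max_right _ _)⟩
  obtain ⟨w, hw, -, ⟨β₁, q', h1, h2, h3, h4⟩, ⟨β₂, p', h5, h6, h7, h8⟩⟩ :=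
    hβ.exists_closest hX hpq hl he (γ b)
  rcases le_total u w with huw | huw
  · obtain ⟨v, hv, hd⟩ := h _ e (by linarith) he β₁ p q' (hw.1.trans h1) h4 s b hs hbs le_rfl
      (by rw [h2 ⟨le_rfl, hw.1⟩, hp]) h3 u ⟨hu.1, huw.trans h1⟩
    rw [h2 ⟨hu.1, huw⟩] at hd
    exact ⟨v, ⟨hv.1, hv.2.trans htb⟩, hd.trans (le_max_left _ _)⟩
  · obtain ⟨v, hv, hd⟩ := h' _ e (by linarith) he β₂ p' q (h5.trans hw.2) h8 b t le_rfl htb ht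
      h7 (by rw [h6 ⟨hw.2, le_rfl⟩, hq]) u ⟨h5.trans huw, hu.2⟩
    rw [h6 ⟨huw, hu.2⟩] at hd
    exact ⟨v, ⟨hbs.trans hv.1, hv.2⟩, hd.trans (le_max_right _ _)⟩

/-- Being Morse passes to fellow travelling paths. -/
theorem MorseBetween.of_fellowTravel (hX : GeodesicSpace X) {γ γ' : ℝ → X} {a b a' b' E : ℝ}
    {M : ℝ → ℝ → ℝ} (h : MorseBetween γ a b M) (φ : ℝ → ℝ) (hφ : Monotone φ) (hφc : Continuous φ)
    (ha : a ≤ φ a') (hb : φ b' ≤ b) (hE : 0 ≤ E)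
    (hd : ∀ t ∈ Icc a' b', dist (γ' t) (γ (φ t)) ≤ E) :
    MorseBetween γ' a' b' (fun lam c => M (4 * lam + 3) (c + (3 * lam + 3) * E) + E) := by
  intro lam c hl hc β p q hpq hβ s t hs hst ht hp hq u hu
  obtain ⟨β', p', q', h1, h2, h3, h4, h5, h6⟩ := hβ.extend_both hX hpq hl hc hE (γ (φ s)) (γ (φ t))
    (by rw [hp, dist_comm]; exact hd s ⟨hs, hst.trans ht⟩)
    (by rw [hq, dist_comm]; exact hd t ⟨hs.trans hst, ht⟩)
  obtain ⟨v, hv, hv'⟩ := h _ _ (by linarith) (by positivity) β' p' q' (h1.trans (hpq.trans h2)) h6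
    (φ s) (φ t) (ha.trans (hφ hs)) (hφ hst) ((hφ ht).trans hb) h4 h5 u
    ⟨h1.trans hu.1, hu.2.trans h2⟩
  obtain ⟨w, hw, rfl⟩ := intermediate_value_Icc hst hφc.continuousOn hv
  refine ⟨w, hw, ?_⟩
  rw [h3 hu] at hv'
  have := hd w ⟨hs.trans hw.1, hw.2.trans ht⟩
  rw [dist_comm] at this
  exact (dist_triangle _ _ _).trans (add_le_add hv' this)

theorem GeodOn.morse_of_length_le {γ : ℝ → X} {a b C : ℝ} (h : GeodOn γ a b) (hC : b - a ≤ C) :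
    MorseBetween γ a b (fun lam c => lam * C + c) := by
  intro lam c hl hc β p q hpq hβ s t hs hst ht hp hq u hu
  refine ⟨s, ⟨le_rfl, hst⟩, ?_⟩
  have h1 := hβ.1 p u le_rfl hu.1 hu.2
  have h2 := hβ.2 p q le_rfl hpq le_rfl
  rw [hp, dist_comm] at h1
  rw [hp, hq, h s t hs hst ht] at h2
  have : lam * (t - s) ≤ lam * C := by gcongr; linarith
  linarith [hu.2]

/-- All geodesics from `x` to `y` are `M`-Morse. -/
def MorsePair (M : ℝ → ℝ → ℝ) (x y : X) : Prop :=
  ∀ (γ : ℝ → X) (a b : ℝ), a ≤ b → GeodOn γ a b → γ a = x → γ b = y → MorseBetween γ a b M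

theorem MorsePair.symm {M : ℝ → ℝ → ℝ} {x y : X} (h : MorsePair M x y) : MorsePair M y x := by
  intro γ a b hab hγ ha hb
  simpa using (h (fun t => γ (-t)) (-b) (-a) (by linarith) hγ.neg (by simpa) (by simpa)).neg

theorem morsePair_of_dist_le {x y : X} {C : ℝ} (h : dist x y ≤ C) :
    MorsePair (fun lam c => lam * C + c) x y := by
  intro γ a b hab hγ ha hb
  apply hγ.morse_of_length_le
  rw [← hγ a b le_rfl hab le_rfl, ha, hb]; exact h

theorem GeodOn.morse_initial (hX : GeodesicSpace X) {M : ℝ → ℝ → ℝ} (hM : ∀ l c, 0 ≤ M l c)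
    {γ : ℝ → X} {a u : ℝ}
    {w : X} (hau : a ≤ u) (hγ : GeodOn γ a u) (h : MorsePair M (γ a) w)
    (hu : ∀ s ∈ Icc a u, dist w (γ u) ≤ dist w (γ s)) :
    MorseBetween γ a u
      (fun lam c => M (4 * lam + 3) (c + (3 * lam + 3) * (2 * M 3 0)) + 2 * M 3 0) := by
  obtain ⟨β', q', h1, h2, h3, h4⟩ := hγ.qgOn.extend hX le_rfl le_rfl le_rfl w
    (fun s hs => by simpa using hu s hs)
  norm_num at h4
  obtain ⟨α, a0, a1, a2⟩ := hX.exists_geodOn (γ a) w a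
  set ℓ := dist (γ a) w
  have hℓ : 0 ≤ ℓ := dist_nonneg
  have hα := h α a (a + ℓ) (by linarith) a2 a0 a1
  refine hα.of_fellowTravel hX (fun t => min t (a + ℓ)) (fun s t hst => min_le_min_right _ hst)
    (by fun_prop) (by simp [hℓ]) (min_le_right _ _) (by linarith [hM 3 0]) (fun t ht => ?_)
  obtain ⟨v, hv, hd⟩ := hα 3 0 (by norm_num) le_rfl β' a q' (hau.trans h1) h4 a (a + ℓ) le_rfl
    (by linarith) le_rfl (by rw [h2 ⟨le_rfl, hau⟩, a0]) (by rw [h3, a1]) t ⟨ht.1, ht.2.trans h1⟩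
  rw [h2 ht] at hd
  have e1 : dist (γ a) (γ t) = t - a := hγ a t le_rfl ht.1 ht.2
  have e2 : dist (γ a) (α v) = v - a := by rw [← a0]; exact a2 a v le_rfl hv.1 hv.2
  have e3 : |v - t| ≤ M 3 0 := by
    rw [abs_le]
    constructor
    · linarith [dist_triangle (γ a) (α v) (γ t), dist_comm (α v) (γ t)]
    · linarith [dist_triangle (γ a) (γ t) (α v)]
  rw [abs_le] at e3
  have e4 : dist (α v) (α (min t (a + ℓ))) ≤ M 3 0 := by
    rcases le_total t (a + ℓ) with htl | htl
    · rw [min_eq_left htl]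
      rcases le_total v t with hvt | hvt
      · rw [a2 v t hv.1 hvt htl]; linarith
      · rw [dist_comm, a2 t v ht.1 hvt hv.2]; linarith
    · rw [min_eq_right htl, a2 v _ hv.1 hv.2 le_rfl]; linarith
  linarith [dist_triangle (γ t) (α v) (α (min t (a + ℓ)))]

theorem MorsePair.mono {M M' : ℝ → ℝ → ℝ} {x y : X} (h : MorsePair M x y)
    (hM : ∀ l c, M l c ≤ M' l c) : MorsePair M' x y :=
  fun γ a b hab hγ ha hb lam c hl hc β p q hpq hβ s t hs hst ht hp hq u hu => by
    obtain ⟨v, hv, hd⟩ := h γ a b hab hγ ha hb lam c hl hc β p q hpq hβ s t hs hst ht hp hq u hu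
    exact ⟨v, hv, hd.trans (hM _ _)⟩

/-- In a geodesic triangle with two Morse sides the third side is Morse. -/
theorem exists_morsePair_trans (hX : GeodesicSpace X) (M₁ M₂ : ℝ → ℝ → ℝ) :
    ∃ M₃ : ℝ → ℝ → ℝ, ∀ x w y : X, MorsePair M₁ x w → MorsePair M₂ w y → MorsePair M₃ x y := by
  set M : ℝ → ℝ → ℝ := fun l c => max 0 (max (M₁ l c) (M₂ l c))
  have hM : ∀ l c, 0 ≤ M l c := fun l c => le_max_left _ _
  set N : ℝ → ℝ → ℝ :=
    fun lam c => M (4 * lam + 3) (c + (3 * lam + 3) * (2 * M 3 0)) + 2 * M 3 0 with hN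
  refine ⟨fun lam e => max (N (2 * lam + 1) e) (N (2 * lam + 1) e),
    fun x w y h1 h2 γ a b hab hγ ha hb => ?_⟩
  replace h1 : MorsePair M x w := h1.mono fun l c => (le_max_left _ _).trans (le_max_right _ _)
  replace h2 : MorsePair M y w :=
    h2.symm.mono fun l c => (le_max_right _ _).trans (le_max_right _ _)
  obtain ⟨u, hu, hmin, -⟩ := hγ.qgOn.exists_closest hX hab le_rfl le_rfl w
  refine MorseBetween.glue hX (b := u) ?_ ?_
  · exact (hγ.sub le_rfl hu.2).morse_initial hX hM hu.1 (by rwa [ha])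
      fun s hs => hmin s ⟨hs.1, hs.2.trans hu.2⟩
  · have := GeodOn.morse_initial hX hM (γ := fun t => γ (-t)) (a := -b) (u := -u) (w := w)
      (by linarith [hu.2]) (hγ.sub hu.1 le_rfl).neg (by simpa [hb])
      (fun s hs => by simpa using hmin (-s) ⟨by linarith [hs.2, hu.1], by linarith [hs.1]⟩)
    simpa using this.neg

end PathGeometry

theorem ProperAction.finite_ball {X G : Type*} [MetricSpace X] [Group G] [MulAction G X]
    (h : ProperAction G X) (o : X) (r : ℝ) : {g : G | dist o (g • o) ≤ r}.Finite :=
  (h o (max r 1) (by positivity)).subset fun g (hg : dist o (g • o) ≤ r) =>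
    show dist o (g • o) ≤ max r 1 from hg.trans (le_max_left _ _)

section GroupAction

variable {X G : Type*} [MetricSpace X] [Group G] [MulAction G X] [IsIsometricSMul G X]

theorem QGOn.smul {γ : ℝ → X} {a b lam c : ℝ} (g : G) (h : QGOn γ a b lam c) :
    QGOn (fun t => g • γ t) a b lam c := by
  simpa only [QGOn, dist_smul] using h

theorem GeodOn.smul {γ : ℝ → X} {a b : ℝ} (g : G) (h : GeodOn γ a b) :
    GeodOn (fun t => g • γ t) a b := by
  simpa only [GeodOn, dist_smul] using h

theorem MorseBetween.smul {γ : ℝ → X} {a b : ℝ} {M : ℝ → ℝ → ℝ} (g : G)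
    (h : MorseBetween γ a b M) : MorseBetween (fun t => g • γ t) a b M := by
  intro lam c hl hc β p q hpq hβ s t hs hst ht hp hq u hu
  obtain ⟨v, hv, hd⟩ := h lam c hl hc (fun t => g⁻¹ • β t) p q hpq (hβ.smul g⁻¹) s t hs hst ht
    (by simp [hp]) (by simp [hq]) u hu
  refine ⟨v, hv, ?_⟩
  rwa [← dist_smul g, smul_inv_smul] at hd

theorem MorsePair.smul {M : ℝ → ℝ → ℝ} {x y : X} (g : G) (h : MorsePair M x y) :
    MorsePair M (g • x) (g • y) := by
  intro γ a b hab hγ ha hb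
  simpa using (h (fun t => g⁻¹ • γ t) a b hab (hγ.smul g⁻¹) (by simp [ha]) (by simp [hb])).smul g

theorem dist_smul_smul_eq (o : X) (x y : G) : dist (x • o) (y • o) = dist o ((x⁻¹ * y) • o) := by
  rw [← dist_smul x⁻¹, inv_smul_smul, mul_smul]

theorem dist_inv_smul_eq (o : X) (x : G) : dist o (x⁻¹ • o) = dist o (x • o) := by
  rw [← dist_smul x, smul_inv_smul, dist_comm]

theorem dist_mul_smul_le (o : X) (x y : G) :
    dist o ((x * y) • o) ≤ dist o (x • o) + dist o (y • o) := by
  rw [mul_smul, ← dist_smul x o (y • o)]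
  exact dist_triangle _ _ _

/-- A form of stability of a subgroup with explicit constants, invariant under translation. -/
structure StableWith (o : X) (H : Subgroup G) (M : ℝ → ℝ → ℝ) (D : ℝ) : Prop where
  gauge_nonneg : ∀ l c, 0 ≤ M l c
  const_nonneg : 0 ≤ D
  morse : ∀ x y : G, x⁻¹ * y ∈ H → MorsePair M (x • o) (y • o)
  near : ∀ x y : G, x⁻¹ * y ∈ H → ∀ (γ : ℝ → X) (a b : ℝ), a ≤ b → GeodOn γ a b →
    γ a = x • o → γ b = y • o → ∀ t ∈ Icc a b, ∃ h ∈ H, dist (γ t) ((x * h) • o) ≤ D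

theorem IsStableSubgroup.exists_stableWith {o : X} {H : Subgroup G} (h : IsStableSubgroup o H) :
    ∃ M D, StableWith o H M D := by
  obtain ⟨M, D, hD, hs⟩ := h
  have key : ∀ x y : G, x⁻¹ * y ∈ H → ∀ (γ : ℝ → X) (a b : ℝ), a ≤ b → GeodOn γ a b →
      γ a = x • o → γ b = y • o → MorseBetween γ a b M ∧
        ∀ t ∈ Icc a b, ∃ h ∈ H, dist (γ t) ((x * h) • o) ≤ D := by
    intro x y hxy γ a b hab hγ ha hb
    have hd : dist o ((x⁻¹ * y) • o) = b - a := by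
      rw [← dist_smul_smul_eq, ← ha, ← hb, hγ a b le_rfl hab le_rfl]
    have := hs _ hxy (fun t => x⁻¹ • γ (a + t)) (by simp [ha])
      (by simp only [hd]; simp [hb, mul_smul])
      (by
        rw [hd]
        intro s t hs ht
        rw [dist_smul]
        rcases le_total s t with hst | hst
        · rw [hγ _ _ (by linarith [hs.1]) (by linarith) (by linarith [ht.2]), abs_sub_comm,
            abs_of_nonneg (by linarith)]
          ring
        · rw [dist_comm, hγ _ _ (by linarith [ht.1]) (by linarith) (by linarith [hs.2]),
            abs_of_nonneg (by linarith)]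
          ring)
    rw [hd, isMorseOn_iff] at this
    constructor
    · have h2 := (this.1.comp_add (-a) (a' := a) (b' := b) (by simp) (by linarith)).smul x
      simpa using h2
    · intro t ht
      obtain ⟨h', hh', hd'⟩ := this.2 (t - a) ⟨by linarith [ht.1], by linarith [ht.2]⟩
      refine ⟨h', hh', ?_⟩
      rw [← dist_smul x] at hd'
      simpa [mul_smul] using hd'
  refine ⟨fun l c => max 0 (M l c), D, fun _ _ => le_max_left _ _, hD, fun x y hxy => ?_,
    fun x y hxy γ a b hab hγ ha hb => (key x y hxy γ a b hab hγ ha hb).2⟩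
  exact MorsePair.mono (M := M) (fun γ a b hab hγ ha hb => (key x y hxy γ a b hab hγ ha hb).1)
    fun _ _ => le_max_right _ _

variable {o : X} {H : Subgroup G} {M : ℝ → ℝ → ℝ} {D : ℝ}

theorem StableWith.qg_near (hX : GeodesicSpace X) (hH : StableWith o H M D) {x y : G}
    (hxy : x⁻¹ * y ∈ H) {lam c : ℝ} (hl : 1 ≤ lam) (hc : 0 ≤ c) {β : ℝ → X} {p q : ℝ}
    (hpq : p ≤ q) (hβ : QGOn β p q lam c) (hp : β p = x • o) (hq : β q = y • o) :
    ∀ u ∈ Icc p q, ∃ h ∈ H, dist (β u) ((x * h) • o) ≤ M lam c + D := by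
  intro u hu
  obtain ⟨γ, h0, h1, h2⟩ := hX.exists_geodOn (x • o) (y • o) 0
  have hℓ : (0:ℝ) ≤ 0 + dist (x • o) (y • o) := by simp
  obtain ⟨v, hv, hd⟩ := hH.morse x y hxy γ 0 _ hℓ h2 h0 h1 lam c hl hc β p q hpq hβ 0 _ le_rfl hℓ
    le_rfl (by rw [hp, h0]) (by rw [hq, h1]) u hu
  obtain ⟨h, hh, hd'⟩ := hH.near x y hxy γ 0 _ hℓ h2 h0 h1 v hv
  exact ⟨h, hh, (dist_triangle _ _ _).trans (add_le_add hd hd')⟩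

/-- Two translates of a stable subgroup that are coarsely infinitely often near each other come
uniformly close. -/
theorem StableWith.close_of_infinite (hX : GeodesicSpace X) (hP : ProperAction G X)
    (hH : StableWith o H M D) (b : G) (r : ℝ)
    (hinf : {h : G | h ∈ H ∧ ∃ h' ∈ H, dist (h • o) ((b * h') • o) ≤ r}.Infinite) :
    ∃ h ∈ H, ∃ h' ∈ H, dist (h • o) ((b * h') • o) ≤ 2 * (M 3 0 + D) := by
  obtain ⟨h₁, hh₁, k₁, hk₁, hd₁⟩ := hinf.nonempty
  have hfin : {g : G | dist (h₁ • o) (g • o) ≤ 5 * r}.Finite := by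
    refine ((hP.finite_ball o (5 * r)).image (h₁ * ·)).subset fun g hg => ?_
    exact ⟨h₁⁻¹ * g, by rwa [mem_ofPred_eq, ← dist_smul_smul_eq], by simp⟩
  obtain ⟨h₂, ⟨hh₂, k₂, hk₂, hd₂⟩, hfar⟩ := (hinf.sdiff hfin).nonempty
  rw [mem_ofPred_eq, not_le] at hfar
  obtain ⟨γ, h0, h1, h2⟩ := hX.exists_geodOn (h₁ • o) ((b * k₂) • o) 0
  set ℓ := 0 + dist (h₁ • o) ((b * k₂) • o) with hℓ
  have hℓ0 : 0 ≤ ℓ := by rw [hℓ, zero_add]; exact dist_nonneg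
  obtain ⟨u, hu, humin, ⟨β₁, q', a1, a2, a3, a4⟩, -⟩ :=
    h2.qgOn.exists_closest hX hℓ0 le_rfl le_rfl (h₂ • o)
  obtain ⟨w, hw, hwmin, -, ⟨β₂, p', b1, b2, b3, b4⟩⟩ :=
    h2.qgOn.exists_closest hX hℓ0 le_rfl le_rfl ((b * k₁) • o)
  norm_num at a4 b4
  have hwu : w ≤ u := by
    have e1 := humin ℓ ⟨hℓ0, le_rfl⟩
    have e2 := hwmin 0 ⟨le_rfl, hℓ0⟩
    rw [h1] at e1
    rw [h0] at e2
    have e3 : dist (γ 0) (γ w) = w - 0 := h2 0 w le_rfl hw.1 hw.2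
    have e4 : dist (γ u) (γ ℓ) = ℓ - u := h2 u ℓ hu.1 hu.2 le_rfl
    rw [h0] at e3
    rw [h1] at e4
    have e5 := dist_triangle (h₁ • o) ((b * k₁) • o) (γ w)
    have e6 := dist_triangle (γ u) (h₂ • o) ((b * k₂) • o)
    have e7 := dist_triangle (h₁ • o) ((b * k₂) • o) (h₂ • o)
    linarith [dist_comm (γ u) (h₂ • o), dist_comm ((b * k₂) • o) (h₂ • o),
      dist_comm ((b * k₁) • o) (h₁ • o)]
  obtain ⟨h, hh, hd⟩ := hH.qg_near hX (H.mul_mem (H.inv_mem hh₁) hh₂) (by norm_num) le_rfl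
    (hu.1.trans a1) a4 (by rw [a2 ⟨le_rfl, hu.1⟩, h0]) a3 w ⟨hw.1, hwu.trans a1⟩
  obtain ⟨h', hh', hd'⟩ := hH.qg_near hX (x := b * k₁) (y := b * k₂)
    (by simpa [mul_assoc] using H.mul_mem (H.inv_mem hk₁) hk₂) (by norm_num) le_rfl
    (b1.trans hw.2) b4 b3 (by rw [b2 ⟨hw.2, le_rfl⟩, h1]) w ⟨b1, hw.2⟩
  rw [a2 ⟨hw.1, hwu⟩] at hd
  rw [b2 ⟨le_rfl, hw.2⟩] at hd'
  refine ⟨h₁ * h, H.mul_mem hh₁ hh, k₁ * h', H.mul_mem hk₁ hh', ?_⟩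
  rw [← mul_assoc]
  rw [dist_comm] at hd
  linarith [dist_triangle ((h₁ * h) • o) (γ w) ((b * k₁ * h') • o)]

/-- If all translates of a stable subgroup are pairwise `C`-close, then those coming closer to the
basepoint pass near the closest point of the others. -/
theorem StableWith.exists_helly (hX : GeodesicSpace X) (hH : StableWith o H M D) {C : ℝ}
    (hC : 0 ≤ C)
    (hclose : ∀ b : G, ∃ h ∈ H, ∃ h' ∈ H, dist (h • o) ((b * h') • o) ≤ C) :
    ∃ C' : ℝ, ∀ b b' : G, (∀ h ∈ H, dist o (b • o) ≤ dist o ((b * h) • o)) →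
      (∀ h ∈ H, dist o (b' • o) ≤ dist o ((b' * h) • o)) → dist o (b' • o) ≤ dist o (b • o) →
      ∃ h ∈ H, dist (b • o) ((b' * h) • o) ≤ C' := by
  have hD := hH.const_nonneg
  obtain ⟨N₁, hN₁⟩ := exists_morsePair_trans hX M (fun lam c => lam * C + c)
  obtain ⟨N₂, hN₂⟩ := exists_morsePair_trans hX N₁ M
  set N : ℝ → ℝ → ℝ := fun l c => max 0 (N₂ l c) with hN
  set E := N 3 (2 * D) with hE
  set E' := N 15 (2 * D + 12 * C) with hE'
  have hE0 : 0 ≤ E := le_max_left _ _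
  have hE'0 : 0 ≤ E' := le_max_left _ _
  set C₁ := max E' C
  set C₂ := M 7 (6 * C₁) + D
  have hC₂ : 0 ≤ C₂ := add_nonneg (hH.gauge_nonneg _ _) hD
  refine ⟨2 * (E + E') + C₂ + E, fun b b' hb hb' hbb => ?_⟩
  obtain ⟨k', hk', k, hk, hkd⟩ := hclose b
  obtain ⟨h, hh, h', hh', hhd⟩ := hclose (b⁻¹ * b')
  set z := (b * h) • o with hz
  set z' := (b' * h') • o with hz'
  have hzz : dist z z' ≤ C := by
    rw [← dist_smul b] at hhd
    simpa [hz, hz', mul_smul] using hhd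
  have hpair : MorsePair N o z := by
    have p1 : MorsePair M ((1 : G) • o) (k' • o) := hH.morse 1 k' (by simpa)
    rw [one_smul] at p1
    have p2 := hN₁ _ _ _ p1 (morsePair_of_dist_le hkd)
    have p3 : MorsePair M ((b * k) • o) z := hH.morse (b * k) (b * h)
      (by simpa [mul_assoc] using H.mul_mem (H.inv_mem hk) hh)
    exact (hN₂ _ _ _ p2 p3).mono fun _ _ => le_max_right _ _
  obtain ⟨η, n0, n1, n2⟩ := hX.exists_geodOn o z 0
  set ℓ := 0 + dist o z with hℓ
  have hℓ0 : 0 ≤ ℓ := by rw [hℓ, zero_add]; exact dist_nonneg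
  have hη : MorseBetween η 0 ℓ N := hpair η 0 ℓ hℓ0 n2 n0 n1
  -- the geodesic from a point of a coset to its closest point extends to the basepoint
  have path : ∀ (a f : G), f ∈ H → (∀ h ∈ H, dist o (a • o) ≤ dist o ((a * h) • o)) →
      ∃ (β : ℝ → X) (q q' : ℝ), 0 ≤ q ∧ q ≤ q' ∧ β 0 = (a * f) • o ∧ β q = a • o ∧ β q' = o ∧
        QGOn β 0 q' 3 (2 * D) := by
    intro a f hf ha
    obtain ⟨δ, d0, d1, d2⟩ := hX.exists_geodOn ((a * f) • o) (a • o) 0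
    set m := 0 + dist ((a * f) • o) (a • o) with hm
    have hm0 : 0 ≤ m := by rw [hm, zero_add]; exact dist_nonneg
    obtain ⟨β', q', c1, c2, c3, c4⟩ := d2.qgOn.extend hX le_rfl le_rfl hD o (by
      intro s hs
      obtain ⟨e, he, hed⟩ := hH.near (a * f) a (by simpa using hf) δ 0 m hm0 d2 d0 d1 s hs
      have := ha (f * e) (H.mul_mem hf he)
      rw [← mul_assoc] at this
      rw [d1]
      linarith [dist_triangle o (δ s) ((a * f * e) • o)])
    exact ⟨β', m, q', hm0, c1, by rw [c2 ⟨le_rfl, hm0⟩, d0], by rw [c2 ⟨hm0, le_rfl⟩, d1], c3,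
      by norm_num at c4; exact c4⟩
  obtain ⟨t₁, ht₁, hd₁⟩ : ∃ t₁ ∈ Icc 0 ℓ, dist (b • o) (η t₁) ≤ E := by
    obtain ⟨β, q, q', c1, c2, c3, c4, c5, c6⟩ := path b h hh hb
    obtain ⟨v, hv, hd⟩ := hη 3 (2 * D) (by norm_num) (by positivity) (fun t => β (-t)) (-q') (-0)
      (by linarith) c6.neg 0 ℓ le_rfl hℓ0 le_rfl (by simp [c5, n0]) (by simp [c3, n1, hz]) (-q)
      ⟨by linarith, by linarith⟩
    exact ⟨v, hv, by simpa [c4] using hd⟩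
  obtain ⟨t₂, ht₂, hd₂⟩ : ∃ t₂ ∈ Icc 0 ℓ, dist (b' • o) (η t₂) ≤ E' := by
    obtain ⟨β, q, q', c1, c2, c3, c4, c5, c6⟩ := path b' h' hh' hb'
    obtain ⟨β', p', q'', e1, e2, e3, e4, e5, e6⟩ := c6.extend_both hX (c1.trans c2) (by norm_num)
      (by positivity) hC z o (by rw [c3]; exact hzz) (by rw [c5, dist_self]; exact hC)
    norm_num at e6
    obtain ⟨v, hv, hd⟩ := hη 15 (2 * D + 12 * C) (by norm_num) (by positivity)
      (fun t => β' (-t)) (-q'') (-p') (by linarith) e6.neg 0 ℓ le_rfl hℓ0 le_rfl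
      (by simp [e5, n0]) (by simp [e4, n1]) (-q) ⟨by linarith, by linarith⟩
    exact ⟨v, hv, by simpa [c4, e3 ⟨c1, c2⟩] using hd⟩
  have g1 : dist o (η t₁) = t₁ := by
    conv_lhs => rw [← n0]
    rw [n2 0 t₁ le_rfl ht₁.1 ht₁.2, sub_zero]
  have g2 : dist o (η t₂) = t₂ := by
    conv_lhs => rw [← n0]
    rw [n2 0 t₂ le_rfl ht₂.1 ht₂.2, sub_zero]
  have g3 : t₂ - t₁ ≤ E + E' := by
    linarith [dist_triangle o (b' • o) (η t₂), dist_triangle o (η t₁) (b • o),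
      dist_comm (b • o) (η t₁)]
  rcases le_total t₁ t₂ with h12 | h21
  · refine ⟨1, H.one_mem, ?_⟩
    rw [mul_one]
    have := n2 t₁ t₂ ht₁.1 h12 ht₂.2
    linarith [dist_triangle4 (b • o) (η t₁) (η t₂) (b' • o), dist_comm (b' • o) (η t₂)]
  · obtain ⟨β, p', q', e1, e2, e3, e4, e5, e6⟩ := (n2.sub ht₂.1 le_rfl).qgOn.extend_both hX ht₂.2
      le_rfl le_rfl (C := C₁) (hC.trans (le_max_right _ _)) (b' • o) z'
      (hd₂.trans (le_max_left _ _))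
      (by rw [n1, dist_comm]; exact hzz.trans (le_max_right _ _))
    norm_num at e6
    obtain ⟨f, hf, hfd⟩ := hH.qg_near hX (x := b') (y := b' * h') (by simpa using hh')
      (by norm_num) (by have := hC.trans (le_max_right E' C); positivity)
      (e1.trans (ht₂.2.trans e2)) e6 e4 e5 t₁ ⟨e1.trans h21, ht₁.2.trans e2⟩
    rw [e3 ⟨h21, ht₁.2⟩] at hfd
    refine ⟨f, hf, ?_⟩
    linarith [dist_triangle (b • o) (η t₁) ((b' * f) • o)]

theorem StableWith.not_forall_close (hX : GeodesicSpace X) (hP : ProperAction G X)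
    (hH : StableWith o H M D) {C : ℝ} (hC : 0 ≤ C) (hindex : H.index = 0) :
    ¬ ∀ b : G, ∃ h ∈ H, ∃ h' ∈ H, dist (h • o) ((b * h') • o) ≤ C := by
  intro hclose
  obtain ⟨C', hC'⟩ := hH.exists_helly hX hC hclose
  have hrep : ∀ q : G ⧸ H, ∃ b : G, (b : G ⧸ H) = q ∧
      ∀ h ∈ H, dist o (b • o) ≤ dist o ((b * h) • o) := by
    intro q
    obtain ⟨g, rfl⟩ := QuotientGroup.mk_surjective q
    have hfin : {f : G | dist o (f • o) ≤ dist o (g • o) ∧ g⁻¹ * f ∈ H}.Finite :=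
      (hP.finite_ball o _).subset fun f hf => hf.1
    obtain ⟨b, ⟨hb1, hb2⟩, hbmin⟩ := hfin.exists_minimalFor (fun f => dist o (f • o)) _
      ⟨g, le_rfl, by simp⟩
    refine ⟨b, (QuotientGroup.eq.2 hb2).symm, fun h hh => ?_⟩
    by_contra! hlt
    exact absurd (hbmin (j := b * h) ⟨hlt.le.trans hb1, by
      rw [← mul_assoc]; exact H.mul_mem hb2 hh⟩ hlt.le) (not_le.2 hlt)
  choose rep hrep1 hrep2 using hrep
  have hinf : Infinite (G ⧸ H) := by
    rw [Subgroup.index_eq_zero_iff_infinite] at hindex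
    exact hindex
  have hfin := hP.finite_ball o C'
  obtain ⟨S, hS⟩ := Infinite.exists_subset_card_eq (G ⧸ H) (hfin.toFinset.card + 1)
  obtain ⟨q₀, hq₀, hmax⟩ := S.exists_max_image (fun q => dist o (rep q • o))
    (Finset.card_pos.1 (by omega))
  have hex : ∀ q : G ⧸ H, q ∈ S → ∃ h ∈ H, dist (rep q₀ • o) ((rep q * h) • o) ≤ C' :=
    fun q hq => hC' _ _ (hrep2 q₀) (hrep2 q) (hmax q hq)
  choose! f hf1 hf2 using hex
  have := Finset.card_le_card_of_injOn (s := S) (t := hfin.toFinset)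
    (fun q => (rep q₀)⁻¹ * (rep q * f q))
    (fun q hq => by simpa [← dist_smul_smul_eq] using hf2 q hq)
    (fun q hq q' hq' heq => by
      simp only [mul_right_inj] at heq
      have e : ∀ q ∈ S, ((rep q * f q : G) : G ⧸ H) = q := fun q hq => by
        rw [QuotientGroup.mk_mul_of_mem _ (hf1 q hq), hrep1]
      rw [← e q hq, ← e q' hq', heq])
  omega

/-- A stable subgroup of infinite index has a translate from which it diverges. -/
theorem StableWith.exists_diverging (hX : GeodesicSpace X) (hP : ProperAction G X)
    (hH : StableWith o H M D) (hindex : H.index = 0) :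
    ∃ b : G, ∀ r : ℝ, {h : G | h ∈ H ∧ ∃ h' ∈ H, dist (h • o) ((b * h') • o) ≤ r}.Finite := by
  by_contra! hcon
  have hC : 0 ≤ 2 * (M 3 0 + D) := by
    have := hH.gauge_nonneg 3 0
    have := hH.const_nonneg
    positivity
  refine hH.not_forall_close hX hP hC hindex fun b => ?_
  obtain ⟨r, hr⟩ := hcon b
  exact hH.close_of_infinite hX hP b r hr

/-- Gromov products between a stable subgroup and a diverging translate are bounded. -/
theorem StableWith.exists_gromov_bound (hX : GeodesicSpace X) (hH : StableWith o H M D) {b : G}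
    (hb : ∀ r : ℝ, {h : G | h ∈ H ∧ ∃ h' ∈ H, dist (h • o) ((b * h') • o) ≤ r}.Finite) :
    ∃ K : ℝ, ∀ h ∈ H, ∀ h' ∈ H,
      dist o (h • o) + dist o (h' • o) ≤ dist (h • o) ((b * h') • o) + K := by
  set B := dist o (b • o) with hB
  have hB0 : 0 ≤ B := dist_nonneg
  set r₁ := M 3 0 + D
  set r₂ := M 15 (12 * B) + D
  obtain ⟨K, hK⟩ := ((hb (r₁ + r₂)).image (fun h => dist o (h • o))).bddAbove
  refine ⟨2 * (K + r₁) + B, fun h hh h' hh' => ?_⟩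
  obtain ⟨η, n0, n1, n2⟩ := hX.exists_geodOn (h • o) ((b * h') • o) 0
  set ℓ := 0 + dist (h • o) ((b * h') • o) with hℓ
  have hℓ0 : 0 ≤ ℓ := by rw [hℓ, zero_add]; exact dist_nonneg
  obtain ⟨u, hu, -, ⟨β₁, q', a1, a2, a3, a4⟩, ⟨β₂, p', b1, b2, b3, b4⟩⟩ :=
    n2.qgOn.exists_closest hX hℓ0 le_rfl le_rfl o
  norm_num at a4 b4
  obtain ⟨k, hk, hkd⟩ := hH.qg_near hX (x := h) (y := 1) (by simpa using hh) (by norm_num) le_rfl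
    (hu.1.trans a1) a4 (by rw [a2 ⟨le_rfl, hu.1⟩, n0]) (by simp [a3]) u ⟨hu.1, a1⟩
  obtain ⟨β₃, p'', q'', c1, c2, c3, c4, c5, c6⟩ := b4.extend_both hX (b1.trans hu.2) (by norm_num)
    le_rfl hB0 (b • o) ((b * h') • o) (by rw [b3, dist_comm])
    (by rw [b2 ⟨hu.2, le_rfl⟩, n1, dist_self]; exact hB0)
  norm_num at c6
  obtain ⟨k', hk', hkd'⟩ := hH.qg_near hX (x := b) (y := b * h') (by simpa using hh')
    (by norm_num) (by positivity) (c1.trans ((b1.trans hu.2).trans c2)) c6 c4 c5 u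
    ⟨c1.trans b1, hu.2.trans c2⟩
  rw [a2 ⟨hu.1, le_rfl⟩] at hkd
  rw [c3 ⟨b1, hu.2⟩, b2 ⟨le_rfl, hu.2⟩] at hkd'
  have e1 : dist o ((h * k) • o) ≤ K := hK ⟨h * k, ⟨H.mul_mem hh hk, k', hk', by
    linarith [dist_triangle ((h * k) • o) (η u) ((b * k') • o), dist_comm (η u) ((h * k) • o)]⟩,
    rfl⟩
  have e2 : dist o (η u) ≤ K + r₁ := by
    linarith [dist_triangle o ((h * k) • o) (η u), dist_comm (η u) ((h * k) • o)]
  have e3 : dist (η 0) (η u) = u - 0 := n2 0 u le_rfl hu.1 hu.2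
  have e4 : dist (η u) (η ℓ) = ℓ - u := n2 u ℓ hu.1 hu.2 le_rfl
  rw [n0] at e3
  rw [n1] at e4
  have e5 : dist o (h' • o) = dist (b • o) ((b * h') • o) := by rw [mul_smul, dist_smul]
  linarith [dist_triangle o (η u) (h • o), dist_comm (η u) (h • o),
    dist_triangle4 (b • o) o (η u) ((b * h') • o), dist_comm (b • o) o]

end GroupAction

section Words

variable {X G : Type*} [MetricSpace X] [Group G] [MulAction G X] [IsIsometricSMul G X]
  {o : X} {H : Subgroup G} {M : ℝ → ℝ → ℝ} {D : ℝ}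

theorem MorseBetween.mono {X : Type*} [MetricSpace X] {γ : ℝ → X} {a b : ℝ} {M M' : ℝ → ℝ → ℝ}
    (h : MorseBetween γ a b M) (hM : ∀ l c, M l c ≤ M' l c) : MorseBetween γ a b M' :=
  fun lam c hl hc β p q hpq hβ s t hs hst ht hp hq u hu => by
    obtain ⟨v, hv, hd⟩ := h lam c hl hc β p q hpq hβ s t hs hst ht hp hq u hu
    exact ⟨v, hv, hd.trans (hM _ _)⟩

/-- Concatenations of an `H`-geodesic, a translate of `[o, b • o]` or its inverse, and another
`H`-geodesic are uniformly Morse quasi-geodesics. -/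
theorem StableWith.exists_bridge (hX : GeodesicSpace X) (hH : StableWith o H M D) {b : G} {K : ℝ}
    (hK : ∀ h ∈ H, ∀ h' ∈ H,
      dist o (h • o) + dist o (h' • o) ≤ dist (h • o) ((b * h') • o) + K) :
    ∃ (N : ℝ → ℝ → ℝ) (C : ℝ), 0 ≤ C ∧ (∀ l c, M l c ≤ N l c) ∧
      ∀ x e h h' : G, e = b ∨ e = b⁻¹ → h ∈ H → h' ∈ H →
        ∀ (γ : ℝ → X) (t₀ t₁ t₂ t₃ : ℝ), t₀ ≤ t₁ → t₁ ≤ t₂ → t₂ ≤ t₃ →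
          GeodOn γ t₀ t₁ → GeodOn γ t₁ t₂ → GeodOn γ t₂ t₃ →
          γ t₀ = (x * h⁻¹) • o → γ t₁ = x • o → γ t₂ = (x * e) • o → γ t₃ = (x * e * h') • o →
          QGOn γ t₀ t₃ 1 C ∧ MorseBetween γ t₀ t₃ N := by
  set B := dist o (b • o) with hB
  set N₁ : ℝ → ℝ → ℝ := fun l c => max (M (2 * l + 1) c) ((2 * l + 1) * B + c)
  refine ⟨fun l c => max (M l c) (max (N₁ (2 * l + 1) c) (M (2 * l + 1) c)), max 0 (K + B),
    le_max_left _ _, fun _ _ => le_max_left _ _,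
    fun x e h h' he hh hh' γ t₀ t₁ t₂ t₃ h01 h12 h23 g1 g2 g3 e0 e1 e2 e3 => ?_⟩
  have hlen : t₂ - t₁ = B := by
    rw [← g2 t₁ t₂ le_rfl h12 le_rfl, e1, e2, mul_smul, dist_smul]
    rcases he with rfl | rfl
    · rfl
    · rw [dist_inv_smul_eq]
  constructor
  · refine (qgOn_of_dist_endpoints (K := K + B) (lipschitz_glue (lipschitz_glue
      (fun s t a1 a2 a3 => (g1 s t a1 a2 a3).le) (fun s t a1 a2 a3 => (g2 s t a1 a2 a3).le))
      (fun s t a1 a2 a3 => (g3 s t a1 a2 a3).le)) ?_).mono le_rfl (le_max_right _ _)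
    have l1 : t₁ - t₀ = dist o (h⁻¹ • o) := by
      rw [← g1 t₀ t₁ le_rfl h01 le_rfl, e0, e1, mul_smul, dist_smul, dist_comm]
    have l3 : t₃ - t₂ = dist o (h' • o) := by
      rw [← g3 t₂ t₃ le_rfl h23 le_rfl, e2, e3, mul_smul (x * e), dist_smul]
    have hd : dist (γ t₀) (γ t₃) = dist (h⁻¹ • o) ((e * h') • o) := by
      rw [e0, e3, mul_assoc, mul_smul, mul_smul, dist_smul]
    rw [hd]
    rcases he with rfl | rfl
    · linarith [hK _ (H.inv_mem hh) _ hh']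
    · have := hK _ hh' _ (H.inv_mem hh)
      have h2 : dist (h⁻¹ • o) ((b⁻¹ * h') • o) = dist (h' • o) ((b * h⁻¹) • o) := by
        rw [mul_smul, mul_smul, ← dist_smul b, smul_inv_smul, dist_comm]
      linarith
  · have m1 : MorseBetween γ t₀ t₁ M :=
      hH.morse (x * h⁻¹) x (by simpa using hh) γ t₀ t₁ h01 g1 e0 e1
    have m2 := g2.morse_of_length_le hlen.le
    have m3 : MorseBetween γ t₂ t₃ M :=
      hH.morse (x * e) (x * e * h') (by rwa [inv_mul_cancel_left]) γ t₂ t₃ h23 g3 e2 e3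
    exact ((m1.glue hX m2).glue hX m3).mono fun _ _ => le_max_right _ _

/-- There is a local Morse quasi-geodesic from `y • o` to `x • o` ending in a long
`H`-geodesic. -/
def LocalMorseTail (o : X) (H : Subgroup G) (N : ℝ → ℝ → ℝ) (C L₀ L : ℝ) (y x : G) : Prop :=
  ∃ (γ : ℝ → X) (T : ℝ) (h : G), h ∈ H ∧ L ≤ dist o (h • o) ∧ 0 ≤ T ∧ γ 0 = y • o ∧
    γ T = (x * h⁻¹) • o ∧ γ (T + dist o (h • o)) = x • o ∧ GeodOn γ T (T + dist o (h • o)) ∧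
    ∀ s t : ℝ, 0 ≤ s → s ≤ t → t ≤ T + dist o (h • o) → t - s ≤ L₀ →
      QGOn γ s t 1 C ∧ MorseBetween γ s t N

theorem StableWith.localMorseTail_start (hX : GeodesicSpace X) (hH : StableWith o H M D)
    {N : ℝ → ℝ → ℝ} {C L₀ L : ℝ} (hC : 0 ≤ C) (hN : ∀ l c, M l c ≤ N l c) (y : G) {h : G}
    (hh : h ∈ H) (hL : L ≤ dist o (h • o)) : LocalMorseTail o H N C L₀ L y (y * h) := by
  obtain ⟨γ, h0, h1, h2⟩ := hX.exists_geodOn (y • o) ((y * h) • o) 0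
  have hd : dist (y • o) ((y * h) • o) = dist o (h • o) := by rw [mul_smul, dist_smul]
  rw [hd] at h1 h2
  refine ⟨γ, 0, h, hh, hL, le_rfl, h0, by simpa using h0, h1, h2, fun s t hs hst ht _ => ⟨?_, ?_⟩⟩
  · exact (h2.qgOn.sub hs ht).mono le_rfl hC
  · exact ((hH.morse y (y * h) (by simpa using hh) γ 0 _ (by simp) h2 h0 h1).sub hs ht).mono hN

theorem LocalMorseTail.step (hX : GeodesicSpace X) {b : G} {N : ℝ → ℝ → ℝ} {C L₀ L : ℝ}
    (hL₀ : L₀ ≤ L)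
    (hbridge : ∀ x e h h' : G, e = b ∨ e = b⁻¹ → h ∈ H → h' ∈ H →
        ∀ (γ : ℝ → X) (t₀ t₁ t₂ t₃ : ℝ), t₀ ≤ t₁ → t₁ ≤ t₂ → t₂ ≤ t₃ →
          GeodOn γ t₀ t₁ → GeodOn γ t₁ t₂ → GeodOn γ t₂ t₃ →
          γ t₀ = (x * h⁻¹) • o → γ t₁ = x • o → γ t₂ = (x * e) • o → γ t₃ = (x * e * h') • o →
          QGOn γ t₀ t₃ 1 C ∧ MorseBetween γ t₀ t₃ N)
    {y x e h' : G} (hx : LocalMorseTail o H N C L₀ L y x) (he : e = b ∨ e = b⁻¹) (hh' : h' ∈ H)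
    (hL : L ≤ dist o (h' • o)) : LocalMorseTail o H N C L₀ L y (x * e * h') := by
  obtain ⟨γ, T, h, hh, hhL, hT, g0, gT, gT', hgeo, hloc⟩ := hx
  set T₁ := T + dist o (h • o) with hT₁
  have hTT₁ : T ≤ T₁ := by simp [hT₁]
  obtain ⟨δ, d0, d1, d2⟩ := hX.exists_geodOn (x • o) ((x * e) • o) T₁
  set T₂ := T₁ + dist (x • o) ((x * e) • o)
  have hT₁₂ : T₁ ≤ T₂ := le_add_of_nonneg_right dist_nonneg
  obtain ⟨η, n0, n1, n2⟩ := hX.exists_geodOn ((x * e) • o) ((x * e * h') • o) T₂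
  have hd : dist ((x * e) • o) ((x * e * h') • o) = dist o (h' • o) := by
    rw [mul_smul (x * e), dist_smul]
  rw [hd] at n1 n2
  set T₃ := T₂ + dist o (h' • o)
  have hT₂₃ : T₂ ≤ T₃ := le_add_of_nonneg_right dist_nonneg
  set β : ℝ → X := fun t => if t ≤ T₁ then γ t else if t ≤ T₂ then δ t else η t with hβ
  have b1 : ∀ t, t ≤ T₁ → β t = γ t := fun t ht => by simp [hβ, ht]
  have b2 : ∀ t, T₁ ≤ t → t ≤ T₂ → β t = δ t := fun t ht ht2 => by
    rcases ht.eq_or_lt with rfl | ht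
    · rw [b1 _ le_rfl, gT', d0]
    · simp [hβ, not_le.2 ht, ht2]
  have b3 : ∀ t, T₂ ≤ t → β t = η t := fun t ht => by
    rcases ht.eq_or_lt with rfl | ht
    · rw [b2 _ hT₁₂ le_rfl, d1, n0]
    · simp [hβ, not_le.2 ht, not_le.2 (hT₁₂.trans_lt ht)]
  have c1 : GeodOn β T T₁ := fun s t a1 a2 a3 => by
    rw [b1 s (a2.trans a3), b1 t a3]; exact hgeo s t a1 a2 a3
  have c2 : GeodOn β T₁ T₂ := fun s t a1 a2 a3 => by
    rw [b2 s a1 (a2.trans a3), b2 t (a1.trans a2) a3]; exact d2 s t a1 a2 a3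
  have c3 : GeodOn β T₂ T₃ := fun s t a1 a2 a3 => by
    rw [b3 s a1, b3 t (a1.trans a2)]; exact n2 s t a1 a2 a3
  have hbr := hbridge x e h h' he hh hh' β T T₁ T₂ T₃ hTT₁ hT₁₂ hT₂₃ c1 c2 c3
    (by rw [b1 _ hTT₁, gT]) (by rw [b1 _ le_rfl, gT']) (by rw [b3 _ le_rfl, n0])
    (by rw [b3 _ hT₂₃, n1])
  refine ⟨β, T₂, h', hh', hL, hT.trans (hTT₁.trans hT₁₂), by rw [b1 _ (hT.trans hTT₁), g0],
    by rw [b3 _ le_rfl, n0, mul_inv_cancel_right], by rw [b3 _ hT₂₃, n1], c3,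
    fun s t hs hst ht hts => ?_⟩
  rcases le_total T s with hTs | hsT
  · exact ⟨hbr.1.sub hTs ht, hbr.2.sub hTs ht⟩
  · have ht₁ : t ≤ T₁ := by linarith
    have heq : EqOn β γ (Icc s t) := fun u hu => b1 u (hu.2.trans ht₁)
    obtain ⟨q1, q2⟩ := hloc s t hs hst ht₁ hts
    exact ⟨q1.congr heq, q2.congr heq⟩

/-- Products `a₀ b a₁ b ⋯ b aₖ` with all `aᵢ` in `A`. -/
def altProducts (A : Set G) (b : G) : ℕ → Set G
  | 0 => A
  | k + 1 => {g | ∃ a ∈ A, ∃ g' ∈ altProducts A b k, g = a * b * g'}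

/-- For sufficiently separated subsets `A` of a stable subgroup of infinite index, alternating
products of elements of `A` and a fixed element `b` are pairwise different. -/
theorem StableWith.exists_injOn_altProducts (hX : GeodesicSpace X) (hP : ProperAction G X)
    (hmltg : MorseLocalToGlobalSpace X) (hH : StableWith o H M D) (hindex : H.index = 0) :
    ∃ (b : G) (L : ℝ), ∀ A : Set G, A ⊆ H → (∀ a ∈ A, L ≤ dist o (a • o)) →
      (∀ a ∈ A, ∀ a' ∈ A, a ≠ a' → L ≤ dist o ((a⁻¹ * a') • o)) →
      ∀ k, ∀ a ∈ A, ∀ a' ∈ A, ∀ g ∈ altProducts A b k, ∀ g' ∈ altProducts A b k,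
        a * b * g = a' * b * g' → a = a' ∧ g = g' := by
  obtain ⟨b, hb⟩ := hH.exists_diverging hX hP hindex
  obtain ⟨K, hK⟩ := hH.exists_gromov_bound hX hb
  obtain ⟨N, C, hC, hN, hbridge⟩ := hH.exists_bridge hX hK
  obtain ⟨N', L₀, lam', c', hL₀, hlam', hc', hglobal⟩ := hmltg N 1 C le_rfl hC
  set L := max L₀ (c' + 1) with hL
  refine ⟨b, L, fun A hAH hAL hAA => ?_⟩
  have step : ∀ {y x e h' : G}, LocalMorseTail o H N C L₀ L y x → e = b ∨ e = b⁻¹ → h' ∈ H →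
      L ≤ dist o (h' • o) → LocalMorseTail o H N C L₀ L y (x * e * h') :=
    fun hx he hh' hL => hx.step hX (le_max_left _ _) hbridge he hh' hL
  have hne : ∀ {y x : G}, LocalMorseTail o H N C L₀ L y x → y ≠ x := by
    rintro y x ⟨γ, T, h, hh, hhL, hT, g0, gT, gT', hgeo, hloc⟩ rfl
    have hTh : 0 ≤ T + dist o (h • o) := add_nonneg hT dist_nonneg
    obtain ⟨hq, -⟩ := hglobal γ (T + dist o (h • o)) hTh fun s t hs hst ht hts => by
      obtain ⟨q1, q2⟩ := hloc s t hs hst ht hts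
      exact ⟨isQuasiGeodesicOn_shift_iff.2 q1, isMorseOn_shift_iff.2 q2⟩
    have := hq.2 0 _ le_rfl hTh le_rfl
    rw [g0, gT', dist_self] at this
    linarith [le_max_right L₀ (c' + 1)]
  have hinv : ∀ k, ∀ g ∈ altProducts A b k, ∀ y, LocalMorseTail o H N C L₀ L y (y * g⁻¹) := by
    intro k
    induction k with
    | zero =>
      intro g hg y
      exact hH.localMorseTail_start hX hC hN y (H.inv_mem (hAH hg))
        (by rw [dist_inv_smul_eq]; exact hAL g hg)
    | succ k ih =>
      rintro _ ⟨a, ha, g, hg, rfl⟩ y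
      have := step (ih g hg y) (Or.inr rfl) (H.inv_mem (hAH ha))
        (by rw [dist_inv_smul_eq]; exact hAL a ha)
      simpa [mul_assoc] using this
  have hext : ∀ k, ∀ g ∈ altProducts A b k, ∀ y x, LocalMorseTail o H N C L₀ L y x →
      LocalMorseTail o H N C L₀ L y (x * b * g) := by
    intro k
    induction k with
    | zero => exact fun g hg y x hx => step hx (Or.inl rfl) (hAH hg) (hAL g hg)
    | succ k ih =>
      rintro _ ⟨a, ha, g, hg, rfl⟩ y x hx
      have := ih g hg y _ (step hx (Or.inl rfl) (hAH ha) (hAL a ha))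
      simpa [mul_assoc] using this
  intro k a ha a' ha' g hg g' hg' heq
  have haa : a = a' := by
    by_contra hne'
    have h1 := hinv k g hg (a * b * g)
    rw [mul_inv_cancel_right] at h1
    have h2 := step h1 (Or.inr rfl) (H.mul_mem (H.inv_mem (hAH ha)) (hAH ha'))
      (hAA a ha a' ha' hne')
    have h3 : a * b * b⁻¹ * (a⁻¹ * a') = a' := by group
    rw [h3] at h2
    exact hne (hext k g' hg' _ _ h2) heq
  subst haa
  exact ⟨rfl, mul_left_cancel heq⟩

end Words

section Growth

/-- Weighted sums over a set of products are at most the product of the weighted sums. -/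
theorem sum_le_sum_mul_sum_of_factor {G : Type*} [Group G] {F A B : Finset G} {u v w : G → ℝ}
    (hv : ∀ a ∈ A, 0 ≤ v a) (hw : ∀ x ∈ B, 0 ≤ w x)
    (h : ∀ f ∈ F, ∃ a ∈ A, ∃ x ∈ B, f = a * x ∧ u f ≤ v a * w x) :
    ∑ f ∈ F, u f ≤ (∑ a ∈ A, v a) * ∑ x ∈ B, w x := by
  classical
  choose! p hp q hq hpq hu using h
  rw [Finset.sum_mul_sum, ← Finset.sum_product']
  have hinj : Set.InjOn (fun f => (p f, q f)) F := fun f hf f' hf' heq => by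
    rw [hpq f hf, hpq f' hf', (Prod.mk.inj heq).1, (Prod.mk.inj heq).2]
  calc ∑ f ∈ F, u f ≤ ∑ f ∈ F, v (p f) * w (q f) := Finset.sum_le_sum hu
    _ = ∑ x ∈ F.image fun f => (p f, q f), v x.1 * w x.2 :=
      (Finset.sum_image (f := fun x : G × G => v x.1 * w x.2) hinj).symm
    _ ≤ ∑ x ∈ A ×ˢ B, v x.1 * w x.2 := by
      refine Finset.sum_le_sum_of_subset_of_nonneg (fun x hx => ?_) fun x hx _ => ?_
      · obtain ⟨f, hf, rfl⟩ := Finset.mem_image.1 hx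
        exact Finset.mem_product.2 ⟨hp f hf, hq f hf⟩
      · rw [Finset.mem_product] at hx
        exact mul_nonneg (hv _ hx.1) (hw _ hx.2)

variable {X G : Type*} [MetricSpace X] [Group G] [MulAction G X]

theorem exists_coarse_surjective [IsIsometricSMul G X] (hC : CocompactAction G X) (o : X) :
    ∃ R : ℝ, 0 ≤ R ∧ ∀ x : X, ∃ g : G, dist x (g • o) ≤ R := by
  obtain ⟨K, hK, hKc⟩ := hC
  obtain ⟨R, hR⟩ := hK.isBounded.subset_closedBall o
  refine ⟨max R 0, le_max_right _ _, fun x => ?_⟩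
  obtain ⟨g, hg⟩ := hKc x
  refine ⟨g⁻¹, (le_of_eq ?_).trans ((Metric.mem_closedBall.1 (hR hg)).trans (le_max_left _ _))⟩
  rw [← dist_smul g, smul_inv_smul]

theorem exists_ncard_ball_le [IsIsometricSMul G X] (hX : GeodesicSpace X) (hP : ProperAction G X)
    (hC : CocompactAction G X) (o : X) :
    ∃ c : ℝ, 1 ≤ c ∧ ∀ n : ℕ, ({g : G | dist o (g • o) ≤ (n : ℝ)}.ncard : ℝ) ≤ c ^ (n + 1) := by
  obtain ⟨R, hR, hRc⟩ := exists_coarse_surjective hC o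
  have hfin := hP.finite_ball o
  have hpos : 1 ≤ {g : G | dist o (g • o) ≤ 2 * R + 1}.ncard := by
    rw [Nat.one_le_iff_ne_zero, ← Nat.pos_iff_ne_zero, Set.ncard_pos (hfin _)]
    exact ⟨1, by simp; linarith⟩
  refine ⟨{g : G | dist o (g • o) ≤ 2 * R + 1}.ncard, by exact_mod_cast hpos, fun n => ?_⟩
  norm_cast
  induction n with
  | zero =>
    rw [pow_one]
    refine Set.ncard_le_ncard (fun g hg => ?_) (hfin _)
    simp only [mem_ofPred_eq, Nat.cast_zero] at hg ⊢
    linarith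
  | succ n ih =>
    rw [pow_succ]
    refine le_trans ?_ (Nat.mul_le_mul_right _ ih)
    have hsub : {g : G | dist o (g • o) ≤ ((n + 1 : ℕ) : ℝ)} ⊆
        (fun p : G × G => p.1 * p.2) ''
          ({g : G | dist o (g • o) ≤ (n : ℝ)} ×ˢ {g : G | dist o (g • o) ≤ 2 * R + 1}) := by
      intro g hg
      simp only [mem_ofPred_eq, Nat.cast_add, Nat.cast_one] at hg
      rcases le_total (dist o (g • o)) (R + 1) with h | h
      · exact ⟨(1, g), ⟨by simp, by simp only [mem_ofPred_eq]; linarith⟩, by simp⟩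
      · obtain ⟨γ, h0, h1, h2⟩ := hX.exists_geodOn o (g • o) 0
        rw [zero_add] at h1 h2
        obtain ⟨f, hf⟩ := hRc (γ (dist o (g • o) - R - 1))
        have e1 := h2 0 (dist o (g • o) - R - 1) le_rfl (by linarith) (by linarith)
        have e2 := h2 (dist o (g • o) - R - 1) _ (by linarith) (by linarith) le_rfl
        rw [h0] at e1
        rw [h1] at e2
        refine ⟨(f, f⁻¹ * g), ⟨?_, ?_⟩, by simp⟩
        · simp only [mem_ofPred_eq]
          linarith [dist_triangle o (γ (dist o (g • o) - R - 1)) (f • o)]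
        · simp only [mem_ofPred_eq]
          rw [← dist_smul_smul_eq]
          linarith [dist_triangle (f • o) (γ (dist o (g • o) - R - 1)) (g • o),
            dist_comm (f • o) (γ (dist o (g • o) - R - 1))]
    have hf := (hfin n).prod (hfin (2 * R + 1))
    calc _ ≤ _ := Set.ncard_le_ncard hsub (hf.image _)
      _ ≤ _ := Set.ncard_image_le hf
      _ = _ := Set.ncard_prod

/-- Balls in the orbit pseudo-metric grow at most exponentially. -/
def ExpBoundedBalls (G : Type*) {X : Type*} [MetricSpace X] [Group G] [MulAction G X] (o : X) :
    Prop :=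
  (∀ r : ℝ, {g : G | dist o (g • o) ≤ r}.Finite) ∧
  ∃ c : ℝ, ∀ (A : Set G) (n : ℕ),
    Real.log ((A ∩ {g : G | dist o (g • o) ≤ (n : ℝ)}).ncard) / (n : ℝ) ≤ c

theorem exists_log_ncard_le [IsIsometricSMul G X] (hX : GeodesicSpace X) (hP : ProperAction G X)
    (hC : CocompactAction G X) (o : X) : ExpBoundedBalls G o := by
  refine ⟨hP.finite_ball o, ?_⟩
  obtain ⟨c, hc, h⟩ := exists_ncard_ball_le hX hP hC o
  have hlog : 0 ≤ Real.log c := Real.log_nonneg hc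
  refine ⟨2 * Real.log c, fun A n => ?_⟩
  rcases Nat.eq_zero_or_pos n with rfl | hn
  · simp only [Nat.cast_zero, div_zero]; positivity
  have hn' : (1 : ℝ) ≤ n := by exact_mod_cast hn
  rw [div_le_iff₀ (by linarith)]
  rcases Nat.eq_zero_or_pos (A ∩ {g : G | dist o (g • o) ≤ (n : ℝ)}).ncard with h0 | h0
  · rw [h0]; simp; positivity
  · have h1 : ((A ∩ {g : G | dist o (g • o) ≤ (n : ℝ)}).ncard : ℝ) ≤ c ^ (n + 1) :=
      (by exact_mod_cast Set.ncard_le_ncard Set.inter_subset_right (hP.finite_ball o n) :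
        ((A ∩ {g : G | dist o (g • o) ≤ (n : ℝ)}).ncard : ℝ) ≤ _).trans (h n)
    have h2 := Real.log_le_log (by exact_mod_cast h0) h1
    rw [Real.log_pow] at h2
    push_cast at h2
    nlinarith

variable {o : X}

theorem log_ncard_div_nonneg (A : Set G) (n : ℕ) :
    0 ≤ Real.log ((A ∩ {g : G | dist o (g • o) ≤ (n : ℝ)}).ncard) / (n : ℝ) :=
  div_nonneg (Real.log_natCast_nonneg _) (Nat.cast_nonneg _)

theorem ExpBoundedBalls.growthRate_nonneg (h : ExpBoundedBalls G o) (A : Set G) :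
    0 ≤ growthRate o A := by
  obtain ⟨-, c, hc⟩ := h
  exact le_limsup_of_frequently_le (Frequently.of_forall (log_ncard_div_nonneg A))
    (isBoundedUnder_of ⟨c, hc A⟩)

theorem ExpBoundedBalls.exists_ncard_le (h : ExpBoundedBalls G o) {A : Set G} {s : ℝ}
    (hs : growthRate o A < s) :
    ∃ C : ℝ, 0 ≤ C ∧ ∀ n : ℕ,
      ((A ∩ {g : G | dist o (g • o) ≤ (n : ℝ)}).ncard : ℝ) ≤ C * Real.exp (s * n) := by
  have hs0 := (h.growthRate_nonneg A).trans_lt hs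
  obtain ⟨hfin, c, hc⟩ := h
  have hev := eventually_lt_of_limsup_lt hs (isBoundedUnder_of ⟨c, hc A⟩)
  obtain ⟨N, hN⟩ := eventually_atTop.1 (hev.and (eventually_gt_atTop 0))
  refine ⟨1 + (A ∩ {g : G | dist o (g • o) ≤ (N : ℝ)}).ncard, by positivity, fun n => ?_⟩
  have hexp : 1 ≤ Real.exp (s * n) := Real.one_le_exp (by positivity)
  rcases le_total n N with hn | hn
  · have : (A ∩ {g : G | dist o (g • o) ≤ (n : ℝ)}).ncard ≤
        (A ∩ {g : G | dist o (g • o) ≤ (N : ℝ)}).ncard := by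
      refine Set.ncard_le_ncard (fun g hg => ⟨hg.1,
        show dist o (g • o) ≤ N from (show dist o (g • o) ≤ n from hg.2).trans
          (by exact_mod_cast hn)⟩)
        ((hfin N).subset Set.inter_subset_right)
    have : ((A ∩ {g : G | dist o (g • o) ≤ (n : ℝ)}).ncard : ℝ) ≤
        (A ∩ {g : G | dist o (g • o) ≤ (N : ℝ)}).ncard := by exact_mod_cast this
    nlinarith
  · obtain ⟨h1, hn0⟩ := hN n hn
    have h2 : ((A ∩ {g : G | dist o (g • o) ≤ (n : ℝ)}).ncard : ℝ) ≤ Real.exp (s * n) := by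
      rcases Nat.eq_zero_or_pos (A ∩ {g : G | dist o (g • o) ≤ (n : ℝ)}).ncard with h0 | h0
      · rw [h0]; simp; positivity
      rw [div_lt_iff₀ (by exact_mod_cast hn0)] at h1
      rw [← Real.log_le_iff_le_exp (by exact_mod_cast h0)]
      exact h1.le
    have : (0 : ℝ) ≤ (A ∩ {g : G | dist o (g • o) ≤ (N : ℝ)}).ncard := Nat.cast_nonneg _
    nlinarith

theorem growthRate_le {A : Set G} {s C : ℝ} (hs : 0 ≤ s)
    (h : ∀ n : ℕ, ((A ∩ {g : G | dist o (g • o) ≤ (n : ℝ)}).ncard : ℝ) ≤ C * Real.exp (s * n)) :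
    growthRate o A ≤ s := by
  set C' := max C 1
  have hC' : 0 < C' := lt_of_lt_of_le one_pos (le_max_right _ _)
  refine le_of_forall_pos_le_add fun ε hε => ?_
  refine limsup_le_of_le ⟨0, fun a ha => ?_⟩ ?_
  · obtain ⟨n, hn⟩ := (eventually_map.1 ha).exists
    exact (log_ncard_div_nonneg A n).trans hn
  · filter_upwards [eventually_ge_atTop (max 1 ⌈Real.log C' / ε⌉₊)] with n hn
    have hn1 : (1 : ℝ) ≤ n := by exact_mod_cast (le_max_left _ _).trans hn
    have hn2 : Real.log C' / ε ≤ n := (Nat.le_ceil _).trans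
      (by exact_mod_cast (le_max_right 1 ⌈Real.log C' / ε⌉₊).trans hn)
    rw [div_le_iff₀ hε] at hn2
    rw [div_le_iff₀ (by linarith)]
    rcases Nat.eq_zero_or_pos (A ∩ {g : G | dist o (g • o) ≤ (n : ℝ)}).ncard with h0 | h0
    · rw [h0]; simp; positivity
    · have h1 := (h n).trans (mul_le_mul_of_nonneg_right (le_max_left C 1) (Real.exp_pos _).le)
      have h2 := Real.log_le_log (by exact_mod_cast h0) h1
      rw [Real.log_mul hC'.ne' (Real.exp_pos _).ne', Real.log_exp] at h2
      linarith

/-- The Poincaré series converges above the growth rate. -/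
theorem ExpBoundedBalls.exists_sum_le (h : ExpBoundedBalls G o) {A : Set G} {s : ℝ}
    (hs : growthRate o A < s) :
    ∃ C : ℝ, ∀ F : Finset G, (F : Set G) ⊆ A →
      ∑ g ∈ F, Real.exp (-s * dist o (g • o)) ≤ C := by
  obtain ⟨s', hs', hss'⟩ := exists_between hs
  have hs0 : 0 < s := (h.growthRate_nonneg A).trans_lt hs
  obtain ⟨C, hC, hcount⟩ := h.exists_ncard_le hs'
  set q := Real.exp (-(s - s')) with hq
  have hq1 : q < 1 := by rw [hq, Real.exp_lt_one_iff]; linarith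
  have hq0 : 0 ≤ q := (Real.exp_pos _).le
  refine ⟨C * Real.exp s * (1 - q)⁻¹, fun F hF => ?_⟩
  obtain ⟨N, hN⟩ : ∃ N : ℕ, ∀ g ∈ F, ⌈dist o (g • o)⌉₊ ∈ Finset.range N :=
    ⟨F.sup (fun g => ⌈dist o (g • o)⌉₊) + 1, fun g hg => Finset.mem_range.2
      (Nat.lt_succ_of_le (Finset.le_sup (f := fun g => ⌈dist o (g • o)⌉₊) hg))⟩
  rw [← Finset.sum_fiberwise_of_maps_to hN]
  have hterm : ∀ n ∈ Finset.range N,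
      ∑ g ∈ F with ⌈dist o (g • o)⌉₊ = n, Real.exp (-s * dist o (g • o)) ≤
        C * Real.exp s * q ^ n := by
    intro n _
    have hle : ∀ g ∈ F.filter (fun g => ⌈dist o (g • o)⌉₊ = n),
        Real.exp (-s * dist o (g • o)) ≤ Real.exp (-s * (n - 1)) := by
      intro g hg
      have := (Finset.mem_filter.1 hg).2
      have h2 := Nat.ceil_lt_add_one (dist_nonneg (x := o) (y := g • o))
      rw [this] at h2
      exact Real.exp_le_exp.2 (by nlinarith)
    have hcard : ((F.filter (fun g => ⌈dist o (g • o)⌉₊ = n)).card : ℝ) ≤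
        C * Real.exp (s' * n) := by
      refine le_trans ?_ (hcount n)
      rw [← Set.ncard_coe_finset]
      refine Nat.cast_le.2 (Set.ncard_le_ncard (fun g hg => ?_)
        ((h.1 n).subset Set.inter_subset_right))
      have hg' := Finset.mem_filter.1 (Finset.mem_coe.1 hg)
      exact ⟨hF hg'.1, show dist o (g • o) ≤ n from hg'.2 ▸ Nat.le_ceil _⟩
    calc _ ≤ ((F.filter (fun g => ⌈dist o (g • o)⌉₊ = n)).card : ℝ) * Real.exp (-s * (n - 1)) := by
          simpa using Finset.sum_le_card_nsmul _ _ _ hle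
      _ ≤ C * Real.exp (s' * n) * Real.exp (-s * (n - 1)) := by gcongr
      _ = C * Real.exp s * q ^ n := by
        rw [hq, ← Real.exp_nat_mul, mul_assoc, mul_assoc, ← Real.exp_add, ← Real.exp_add]
        ring_nf
  refine (Finset.sum_le_sum hterm).trans ?_
  rw [← Finset.mul_sum]
  gcongr
  rw [← tsum_geometric_of_lt_one hq0 hq1]
  exact (summable_geometric_of_lt_one hq0 hq1).sum_le_tsum _ fun _ _ => pow_nonneg hq0 _

end Growth

section Divergence

variable {X G : Type*} [MetricSpace X] [Group G] [MulAction G X] [IsIsometricSMul G X]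
  {o : X} {H : Subgroup G} {M : ℝ → ℝ → ℝ} {D : ℝ}

/-- An element of a stable subgroup factors coarsely at any given distance. -/
theorem StableWith.exists_factor (hX : GeodesicSpace X) (hH : StableWith o H M D) {h : G}
    (hh : h ∈ H) {r : ℝ} (hr : 0 ≤ r) (hrh : r ≤ dist o (h • o)) :
    ∃ h₁ ∈ H, h₁⁻¹ * h ∈ H ∧ |dist o (h₁ • o) - r| ≤ D ∧
      |dist o ((h₁⁻¹ * h) • o) - (dist o (h • o) - r)| ≤ D := by
  obtain ⟨γ, h0, h1, h2⟩ := hX.exists_geodOn o (h • o) 0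
  rw [zero_add] at h1 h2
  obtain ⟨h₁, hh₁, hd⟩ := hH.near 1 h (by simpa using hh) γ 0 _ dist_nonneg h2 (by simpa using h0)
    h1 r ⟨hr, hrh⟩
  rw [one_mul] at hd
  have e1 := h2 0 r le_rfl hr hrh
  have e2 := h2 r _ hr hrh le_rfl
  rw [h0, sub_zero] at e1
  rw [h1] at e2
  refine ⟨h₁, hh₁, H.mul_mem (H.inv_mem hh₁) hh, ?_, ?_⟩
  · rw [abs_le]
    constructor
    · linarith [dist_triangle o (h₁ • o) (γ r), dist_comm (h₁ • o) (γ r)]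
    · linarith [dist_triangle o (γ r) (h₁ • o)]
  · rw [← dist_smul_smul_eq, abs_le]
    constructor
    · linarith [dist_triangle (γ r) (h₁ • o) (h • o)]
    · linarith [dist_triangle (h₁ • o) (γ r) (h • o), dist_comm (h₁ • o) (γ r)]

/-- The Poincaré series of an infinite stable subgroup diverges at its growth rate. -/
theorem StableWith.exists_lt_sum (hX : GeodesicSpace X) (hE : ExpBoundedBalls G o)
    (hH : StableWith o H M D) (hinf : (H : Set G).Infinite) (B : ℝ) :
    ∃ F : Finset G, (F : Set G) ⊆ H ∧
      B < ∑ h ∈ F, Real.exp (-growthRate o (H : Set G) * dist o (h • o)) := by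
  classical
  by_contra! hB
  set ω := growthRate o (H : Set G) with hω
  have hD := hH.const_nonneg
  rcases (hE.growthRate_nonneg (H : Set G)).eq_or_lt with h0 | hpos
  · obtain ⟨F, hF, hcard⟩ := hinf.exists_subset_card_eq (⌈B⌉₊ + 1)
    have := hB F hF
    rw [← hω] at h0
    rw [← h0] at this
    simp only [neg_zero, zero_mul, Real.exp_zero, Finset.sum_const, nsmul_eq_mul, mul_one,
      hcard] at this
    push_cast at this
    linarith [Nat.le_ceil B]
  rw [← hω] at hpos
  set ball : ℝ → Finset G := fun r =>
    ((hE.1 r).subset (inter_subset_right (s := (H : Set G)))).toFinset with hball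
  have mem_ball : ∀ r h, h ∈ ball r ↔ h ∈ H ∧ dist o (h • o) ≤ r := fun r h => by
    simp only [hball, Set.Finite.mem_toFinset]
    rfl
  -- the weight of the annulus at distance `N`
  obtain ⟨N, hND, A, hA, hAH, hθ⟩ : ∃ N : ℝ, D + 1 ≤ N ∧ ∃ A : Finset G,
      (∀ h ∈ H, |dist o (h • o) - N| ≤ D → h ∈ A) ∧ (∀ h ∈ A, h ∈ H) ∧
      ∑ h ∈ A, Real.exp (-ω * (dist o (h • o) - 2 * D)) < 1 := by
    have hsum : Summable fun h : H => Real.exp (-ω * dist o ((h : G) • o)) := by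
      refine summable_of_sum_le (fun _ => (Real.exp_pos _).le) (c := B) fun u => ?_
      have := hB (u.map (Function.Embedding.subtype _)) (by
        intro g hg
        simp only [Finset.coe_map, Set.mem_image] at hg
        obtain ⟨x, -, rfl⟩ := hg
        exact x.2)
      simpa using this
    obtain ⟨S, hS⟩ := summable_iff_vanishing_norm.1 hsum (Real.exp (-ω * (2 * D)))
      (Real.exp_pos _)
    obtain ⟨m, hm⟩ := (S.finite_toSet.image fun h : H => dist o ((h : G) • o)).bddAbove
    set N := max (D + 1) (m + D + 1)
    set A := (ball (N + D)).filter fun h => |dist o (h • o) - N| ≤ D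
    refine ⟨N, le_max_left _ _, A, fun h hh hd => Finset.mem_filter.2 ⟨(mem_ball _ _).2 ⟨hh, by
      linarith [(abs_le.1 hd).2]⟩, hd⟩, fun h hh => ((mem_ball _ _).1 (Finset.mem_filter.1 hh).1).1,
      ?_⟩
    have hA : ∀ h ∈ A, h ∈ H := fun h hh => ((mem_ball _ _).1 (Finset.mem_filter.1 hh).1).1
    have h1 := hS (A.subtype (· ∈ H)) (by
      rw [Finset.disjoint_left]
      intro h hh hhS
      have h2 := (abs_le.1 (Finset.mem_filter.1 (Finset.mem_subtype.1 hh)).2).1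
      have h3 : dist o ((h : G) • o) ≤ m := hm ⟨h, hhS, rfl⟩
      linarith [le_max_right (D + 1) (m + D + 1)])
    have h4 : ∑ h ∈ A.subtype (· ∈ H), Real.exp (-ω * dist o ((h : G) • o)) =
        ∑ h ∈ A, Real.exp (-ω * dist o (h • o)) :=
      Finset.sum_subtype_of_mem (fun h => Real.exp (-ω * dist o (h • o))) hA
    rw [h4] at h1
    have h5 := (le_abs_self _).trans_lt h1
    have h6 : ∑ h ∈ A, Real.exp (-ω * (dist o (h • o) - 2 * D)) =
        (∑ h ∈ A, Real.exp (-ω * dist o (h • o))) * Real.exp (ω * (2 * D)) := by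
      rw [Finset.sum_mul]
      refine Finset.sum_congr rfl fun h _ => ?_
      rw [← Real.exp_add]; ring_nf
    rw [h6]
    calc _ < Real.exp (-ω * (2 * D)) * Real.exp (ω * (2 * D)) := by gcongr
      _ = 1 := by rw [← Real.exp_add]; simp
  obtain ⟨s, hs0, hsω, hθs⟩ : ∃ s : ℝ, 0 ≤ s ∧ s < ω ∧
      ∑ h ∈ A, Real.exp (-s * (dist o (h • o) - 2 * D)) < 1 := by
    have hcont : Continuous fun s : ℝ => ∑ h ∈ A, Real.exp (-s * (dist o (h • o) - 2 * D)) := by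
      fun_prop
    have hev : ∀ᶠ s in nhdsWithin ω (Iio ω),
        ∑ h ∈ A, Real.exp (-s * (dist o (h • o) - 2 * D)) < 1 :=
      (hcont.continuousAt.eventually_lt continuousAt_const hθ).filter_mono nhdsWithin_le_nhds
    obtain ⟨s, h1, h2⟩ := (hev.and (Ioo_mem_nhdsLT hpos)).exists
    exact ⟨s, h2.1.le, h2.2, h1⟩
  set θ := ∑ h ∈ A, Real.exp (-s * (dist o (h • o) - 2 * D)) with hθdef
  have hθ0 : 0 ≤ θ := Finset.sum_nonneg fun _ _ => (Real.exp_pos _).le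
  set f : ℝ → ℝ := fun r => ∑ h ∈ ball r, Real.exp (-s * dist o (h • o)) with hf
  have hf0 : ∀ r, 0 ≤ f r := fun r => Finset.sum_nonneg fun _ _ => (Real.exp_pos _).le
  have hrec : ∀ r, f (r + 1) ≤ f N + θ * f r := by
    intro r
    simp only [hf]
    rw [← Finset.sum_filter_add_sum_filter_not (ball (r + 1)) (fun h => dist o (h • o) ≤ N)]
    refine add_le_add (Finset.sum_le_sum_of_subset_of_nonneg (fun h hh => ?_)
      fun _ _ _ => (Real.exp_pos _).le) (sum_le_sum_mul_sum_of_factor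
      (fun _ _ => (Real.exp_pos _).le) (fun _ _ => (Real.exp_pos _).le) fun h hh => ?_)
    · obtain ⟨h1, h2⟩ := Finset.mem_filter.1 hh
      exact (mem_ball _ _).2 ⟨((mem_ball _ _).1 h1).1, h2⟩
    · obtain ⟨h1, h2⟩ := Finset.mem_filter.1 hh
      obtain ⟨h3, h4⟩ := (mem_ball _ _).1 h1
      rw [not_le] at h2
      obtain ⟨h₁, e1, e2, e3, e4⟩ := hH.exists_factor hX h3 (by linarith : 0 ≤ N) h2.le
      have e5 := (abs_le.1 e3).2
      have e6 := (abs_le.1 e4).2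
      refine ⟨h₁, hA _ e1 e3, h₁⁻¹ * h, (mem_ball _ _).2 ⟨e2, by linarith⟩, by simp, ?_⟩
      rw [← Real.exp_add, Real.exp_le_exp]
      nlinarith
  have hbdd : ∀ n : ℕ, f n ≤ f N / (1 - θ) := by
    have h1θ : 0 < 1 - θ := by linarith
    intro n
    induction n with
    | zero =>
      have h1 : f (0 : ℕ) ≤ f N := Finset.sum_le_sum_of_subset_of_nonneg (fun h hh => by
        rw [mem_ball] at hh ⊢
        exact ⟨hh.1, hh.2.trans (by push_cast; linarith)⟩) fun _ _ _ => (Real.exp_pos _).le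
      refine h1.trans ?_
      rw [le_div_iff₀ h1θ]
      nlinarith [hf0 N]
    | succ n ih =>
      have h1 := hrec n
      rw [le_div_iff₀ h1θ] at ih ⊢
      push_cast
      nlinarith
  have : ω ≤ s := growthRate_le hs0 (C := f N / (1 - θ)) fun n => by
    have h1 : ((H : Set G) ∩ {g : G | dist o (g • o) ≤ (n : ℝ)}) = (ball n : Set G) := by
      ext g; rw [Finset.mem_coe, mem_ball]; rfl
    rw [h1, Set.ncard_coe_finset]
    have h2 : ((ball n).card : ℝ) * Real.exp (-s * n) ≤ f n := by
      rw [← nsmul_eq_mul]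
      refine Finset.card_nsmul_le_sum _ _ _ fun h hh => Real.exp_le_exp.2 ?_
      have := ((mem_ball _ _).1 hh).2
      nlinarith
    have h3 := h2.trans (hbdd n)
    rw [neg_mul, Real.exp_neg, ← div_eq_mul_inv, div_le_iff₀ (Real.exp_pos _)] at h3
    exact h3
  linarith

theorem exists_separated_subset (F : Finset G) (o : X) (L : ℝ) :
    ∃ A ⊆ F, (∀ a ∈ A, ∀ a' ∈ A, a ≠ a' → L ≤ dist o ((a⁻¹ * a') • o)) ∧
      ∀ f ∈ F, ∃ a ∈ A, dist o ((a⁻¹ * f) • o) ≤ max L 0 := by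
  classical
  obtain ⟨A, hA, hmax⟩ := Finset.exists_max_image
    (F.powerset.filter fun A => ∀ a ∈ A, ∀ a' ∈ A, a ≠ a' → L ≤ dist o ((a⁻¹ * a') • o))
    Finset.card ⟨∅, by simp⟩
  obtain ⟨hAF, hsep⟩ := Finset.mem_filter.1 hA
  rw [Finset.mem_powerset] at hAF
  refine ⟨A, hAF, hsep, fun f hf => ?_⟩
  by_contra! hcon
  have hfA : f ∉ A := fun h => by
    have := hcon f h
    simp at this
  have hsymm : ∀ a, dist o ((f⁻¹ * a) • o) = dist o ((a⁻¹ * f) • o) := fun a => by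
    rw [← dist_inv_smul_eq, mul_inv_rev, inv_inv]
  have := hmax (insert f A) (Finset.mem_filter.2 ⟨Finset.mem_powerset.2
    (Finset.insert_subset hf hAF), fun a ha a' ha' hne => by
      rcases Finset.mem_insert.1 ha with e | h₁ <;> rcases Finset.mem_insert.1 ha' with e' | h₂
      · exact absurd (e.trans e'.symm) hne
      · rw [e, hsymm]; exact (le_max_left _ _).trans (hcon a' h₂).le
      · rw [e']; exact (le_max_left _ _).trans (hcon a h₁).le
      · exact hsep a h₁ a' h₂ hne⟩)
  rw [Finset.card_insert_of_notMem hfA] at this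
  omega

/-- The growth rate gap for infinite stable subgroups. -/
theorem StableWith.growthRate_lt (hX : GeodesicSpace X) (hP : ProperAction G X)
    (hE : ExpBoundedBalls G o)
    (hmltg : MorseLocalToGlobalSpace X) (hH : StableWith o H M D) (hindex : H.index = 0)
    (hinf : (H : Set G).Infinite) :
    growthRate o (H : Set G) < growthRate o (univ : Set G) := by
  classical
  obtain ⟨b, L, hbL⟩ := hH.exists_injOn_altProducts hX hP hmltg hindex
  by_contra! hle
  set ω := growthRate o (H : Set G) with hω
  have hω0 : 0 ≤ ω := hE.growthRate_nonneg _
  set ball := (hE.1 (max L 0)).toFinset with hball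
  have mem_ball : ∀ g, g ∈ ball ↔ dist o (g • o) ≤ max L 0 := fun g => by
    simp only [hball, Set.Finite.mem_toFinset]
    rfl
  set β := dist o (b • o) with hβ
  obtain ⟨A, hAH, hAL, hAA, hA1⟩ : ∃ A : Finset G, (∀ a ∈ A, a ∈ H) ∧
      (∀ a ∈ A, L ≤ dist o (a • o)) ∧
      (∀ a ∈ A, ∀ a' ∈ A, a ≠ a' → L ≤ dist o ((a⁻¹ * a') • o)) ∧
      1 < ∑ a ∈ A, Real.exp (-ω * (dist o (a • o) + β)) := by
    set κ := ∑ _x ∈ ball, Real.exp (ω * max L 0) with hκ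
    obtain ⟨F, hFH, hF⟩ := hH.exists_lt_sum hX hE hinf (κ * Real.exp (ω * β) + ball.card)
    rw [← hω] at hF
    obtain ⟨A, hAF, hsep, hnear⟩ := exists_separated_subset (F.filter fun f => L ≤ dist o (f • o))
      o L
    refine ⟨A, fun a ha => hFH (Finset.mem_filter.1 (hAF ha)).1,
      fun a ha => (Finset.mem_filter.1 (hAF ha)).2, hsep, ?_⟩
    have h1 : ∑ f ∈ F with L ≤ dist o (f • o), Real.exp (-ω * dist o (f • o)) ≤
        (∑ a ∈ A, Real.exp (-ω * dist o (a • o))) * κ := by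
      refine sum_le_sum_mul_sum_of_factor (fun _ _ => (Real.exp_pos _).le)
        (fun _ _ => (Real.exp_pos _).le) fun f hf => ?_
      obtain ⟨a, ha, hd⟩ := hnear f hf
      refine ⟨a, ha, a⁻¹ * f, (mem_ball _).2 hd, by simp, ?_⟩
      rw [← Real.exp_add, Real.exp_le_exp]
      have := dist_mul_smul_le o f (a⁻¹ * f)⁻¹
      rw [dist_inv_smul_eq, show f * (a⁻¹ * f)⁻¹ = a by group] at this
      nlinarith
    have h2 : ∑ f ∈ F with ¬ L ≤ dist o (f • o), Real.exp (-ω * dist o (f • o)) ≤ ball.card := by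
      calc _ ≤ ∑ f ∈ F with ¬ L ≤ dist o (f • o), (1 : ℝ) :=
            Finset.sum_le_sum fun f _ => Real.exp_le_one_iff.2 (by
              have := mul_nonneg hω0 (dist_nonneg (x := o) (y := f • o)); linarith)
        _ ≤ ∑ f ∈ ball, (1 : ℝ) := by
            refine Finset.sum_le_sum_of_subset_of_nonneg (fun f hf => ?_) fun _ _ _ => zero_le_one
            exact (mem_ball f).2 ((not_le.1 (Finset.mem_filter.1 hf).2).le.trans (le_max_left _ _))
        _ = _ := by simp
    rw [← Finset.sum_filter_add_sum_filter_not F (fun f => L ≤ dist o (f • o))] at hF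
    have hκ0 : 0 < κ := by
      refine Finset.sum_pos (fun _ _ => Real.exp_pos _) ⟨1, (mem_ball 1).2 ?_⟩
      simp
    have h3 : κ * Real.exp (ω * β) < (∑ a ∈ A, Real.exp (-ω * dist o (a • o))) * κ := by linarith
    rw [mul_comm, mul_lt_mul_iff_left₀ hκ0] at h3
    calc (1 : ℝ) = Real.exp (ω * β) * Real.exp (-ω * β) := by rw [← Real.exp_add]; simp
      _ < (∑ a ∈ A, Real.exp (-ω * dist o (a • o))) * Real.exp (-ω * β) := by gcongr
      _ = _ := by
        rw [Finset.sum_mul]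
        refine Finset.sum_congr rfl fun a _ => ?_
        rw [← Real.exp_add]; ring_nf
  obtain ⟨s, hsω, hθ⟩ : ∃ s : ℝ, ω < s ∧ 1 < ∑ a ∈ A, Real.exp (-s * (dist o (a • o) + β)) := by
    have hcont : Continuous fun s : ℝ => ∑ a ∈ A, Real.exp (-s * (dist o (a • o) + β)) := by
      fun_prop
    have hev : ∀ᶠ s in nhdsWithin ω (Ioi ω), 1 < ∑ a ∈ A, Real.exp (-s * (dist o (a • o) + β)) :=
      (continuousAt_const.eventually_lt hcont.continuousAt hA1).filter_mono nhdsWithin_le_nhds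
    obtain ⟨s, h1, h2⟩ := (hev.and self_mem_nhdsWithin).exists
    exact ⟨s, h2, h1⟩
  have hs0 : 0 < s := hω0.trans_lt hsω
  set θ := ∑ a ∈ A, Real.exp (-s * (dist o (a • o) + β)) with hθdef
  obtain ⟨C, hC⟩ := hE.exists_sum_le (hle.trans_lt hsω)
  have hwords : ∀ k : ℕ, ∃ E : Finset G, (∀ g ∈ E, g ∈ altProducts (A : Set G) b k) ∧
      θ ^ k * θ ≤ ∑ g ∈ E, Real.exp (-s * dist o (g • o)) := by
    intro k
    induction k with
    | zero =>
      refine ⟨A, fun g hg => hg, ?_⟩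
      rw [pow_zero, one_mul]
      refine Finset.sum_le_sum fun a _ => Real.exp_le_exp.2 ?_
      have : 0 ≤ β := dist_nonneg
      nlinarith
    | succ k ih =>
      obtain ⟨E, hE1, hE2⟩ := ih
      refine ⟨(A ×ˢ E).image fun p => p.1 * b * p.2, fun g hg => ?_, ?_⟩
      · obtain ⟨⟨a, e⟩, hp, rfl⟩ := Finset.mem_image.1 hg
        rw [Finset.mem_product] at hp
        exact ⟨a, hp.1, e, hE1 e hp.2, rfl⟩
      · rw [Finset.sum_image, Finset.sum_product]
        · calc θ ^ (k + 1) * θ = θ * (θ ^ k * θ) := by ring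
            _ ≤ θ * ∑ g ∈ E, Real.exp (-s * dist o (g • o)) := by gcongr
            _ = ∑ a ∈ A, ∑ g ∈ E, Real.exp (-s * (dist o (a • o) + β)) *
                  Real.exp (-s * dist o (g • o)) := Finset.sum_mul_sum _ _ _ _
            _ ≤ _ := by
              refine Finset.sum_le_sum fun a _ => Finset.sum_le_sum fun g _ => ?_
              rw [← Real.exp_add, Real.exp_le_exp]
              have h1 := dist_mul_smul_le o (a * b) g
              have h2 := dist_mul_smul_le o a b
              simp only at h1 h2 ⊢
              nlinarith
        · rintro ⟨a, e⟩ hp ⟨a', e'⟩ hp' heq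
          rw [Finset.mem_coe, Finset.mem_product] at hp hp'
          obtain ⟨rfl, rfl⟩ := hbL A (fun a ha => hAH a ha) hAL hAA k a hp.1 a' hp'.1 e
            (hE1 e hp.2) e' (hE1 e' hp'.2) heq
          rfl
  obtain ⟨k, hk⟩ := pow_unbounded_of_one_lt C hθ
  obtain ⟨E, -, hE2⟩ := hwords k
  have h1 := hE2.trans (hC E (subset_univ _))
  have h2 : 0 ≤ θ ^ k := by positivity
  nlinarith

end Divergence

section MorseChains

/-- The core of `exists_gauge_of_same_endpoints` below: a quasi-geodesic between points of a
geodesic that fellow-travels a Morse quasi-geodesic. -/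
theorem MorseBetween.near_geodesic {X : Type*} [MetricSpace X] (hX : GeodesicSpace X)
    {P : ℝ → X} {a b lam c E E₃ : ℝ}
    {M : ℝ → ℝ → ℝ} (hlam : 1 ≤ lam) (hP : QGOn P a b lam c) (hM : MorseBetween P a b M)
    (hE : 0 ≤ E) (hE₃ : max E (M 7 (6 * E)) ≤ E₃) {η : ℝ → X} {s t v₁ v₂ : ℝ} (hst : s ≤ t)
    (hη : GeodOn η s t) (hv : v₁ ≤ v₂) (ha : a ≤ v₁) (hb : v₂ ≤ b) (h₁ : dist (P v₁) (η s) ≤ E)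
    (h₂ : dist (P v₂) (η t) ≤ E) {l e : ℝ} (hl : 1 ≤ l) (he : 0 ≤ e) {β : ℝ → X} {p q : ℝ}
    (hpq : p ≤ q) (hβ : QGOn β p q l e) (hp : β p = η s) (hq : β q = η t) :
    ∀ u ∈ Icc p q, ∃ x ∈ Icc s t,
      dist (β u) (η x) ≤ M (4 * l + 3) (e + (3 * l + 3) * E) + (2 * lam * E₃ + c + E₃) := by
  intro u hu
  obtain ⟨β', p', q', b1, b2, b3, b4, b5, b6⟩ := hβ.extend_both hX hpq hl he hE (P v₁) (P v₂)
    (by rwa [hp]) (by rwa [hq])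
  obtain ⟨v, hv', hd⟩ := hM _ _ (by linarith) (by positivity) β' p' q' (b1.trans (hpq.trans b2)) b6
    v₁ v₂ ha hv hb b4 b5 u ⟨b1.trans hu.1, hu.2.trans b2⟩
  rw [b3 hu] at hd
  have hE₃E : E ≤ E₃ := (le_max_left _ _).trans hE₃
  obtain ⟨η', p'', q'', c1, c2, c3, c4, c5, c6⟩ := hη.qgOn.extend_both hX hst le_rfl le_rfl hE
    (P v₁) (P v₂) h₁ h₂
  norm_num at c6
  have hnear : ∀ x ∈ Icc s t, ∃ w ∈ Icc v₁ v₂, dist (η x) (P w) ≤ E₃ := fun x hx => by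
    obtain ⟨w, hw, hd⟩ := hM 7 (6 * E) (by norm_num) (by positivity) η' p'' q''
      (c1.trans (hst.trans c2)) c6 v₁ v₂ ha hv hb c4 c5 x ⟨c1.trans hx.1, hx.2.trans c2⟩
    rw [c3 hx] at hd
    exact ⟨w, hw, hd.trans ((le_max_right _ _).trans hE₃)⟩
  have hPc := hP.continuousOn
  have hclosed : ∀ w₁ w₂, a ≤ w₁ → w₂ ≤ b →
      ∃ S : Set ℝ, IsClosed S ∧ ∀ x ∈ Icc s t, x ∈ S ↔ ∃ w ∈ Icc w₁ w₂, dist (η x) (P w) ≤ E₃ := by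
    intro w₁ w₂ hw₁ hw₂
    have hcomp : IsCompact (P '' Icc w₁ w₂) :=
      isCompact_Icc.image_of_continuousOn (hPc.mono (Icc_subset_Icc hw₁ hw₂))
    rcases (P '' Icc w₁ w₂).eq_empty_or_nonempty with hem | hne
    · refine ⟨∅, isClosed_empty, fun x _ => ?_⟩
      rw [image_eq_empty] at hem
      simp [hem]
    refine ⟨Icc s t ∩ {x | infDist (η x) (P '' Icc w₁ w₂) ≤ E₃}, ?_, fun x hx => ?_⟩
    · exact ((continuous_infDist_pt _).comp_continuousOn
        hη.qgOn.continuousOn).preimage_isClosed_of_isClosed isClosed_Icc isClosed_Iic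
    · constructor
      · rintro ⟨-, h⟩
        obtain ⟨_, ⟨w, hw, rfl⟩, hd⟩ := hcomp.exists_infDist_eq_dist hne (η x)
        exact ⟨w, hw, hd ▸ h⟩
      · rintro ⟨w, hw, h⟩
        exact ⟨hx, (infDist_le_dist_of_mem (mem_image_of_mem _ hw)).trans h⟩
  obtain ⟨S₁, hS₁, hS₁'⟩ := hclosed v₁ v ha (hv'.2.trans hb)
  obtain ⟨S₂, hS₂, hS₂'⟩ := hclosed v v₂ (ha.trans hv'.1) hb
  obtain ⟨x, hx, hx₁, hx₂⟩ := isPreconnected_closed_iff.1 (isPreconnected_Icc (a := s) (b := t))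
    S₁ S₂ hS₁ hS₂ (fun x hx => by
      obtain ⟨w, hw, hd⟩ := hnear x hx
      rcases le_total w v with h | h
      · exact Or.inl ((hS₁' x hx).2 ⟨w, ⟨hw.1, h⟩, hd⟩)
      · exact Or.inr ((hS₂' x hx).2 ⟨w, ⟨h, hw.2⟩, hd⟩))
    ⟨s, ⟨le_rfl, hst⟩, (hS₁' s ⟨le_rfl, hst⟩).2 ⟨v₁, ⟨le_rfl, hv'.1⟩, by
      rw [dist_comm]; exact h₁.trans hE₃E⟩⟩
    ⟨t, ⟨hst, le_rfl⟩, (hS₂' t ⟨hst, le_rfl⟩).2 ⟨v₂, ⟨hv'.2, le_rfl⟩, by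
      rw [dist_comm]; exact h₂.trans hE₃E⟩⟩
  obtain ⟨w₁, hw₁, hd₁⟩ := (hS₁' x hx).1 hx₁
  obtain ⟨w₂, hw₂, hd₂⟩ := (hS₂' x hx).1 hx₂
  refine ⟨x, hx, ?_⟩
  have e1 := hP.2 w₁ w₂ (ha.trans hw₁.1) (hw₁.2.trans hw₂.1) (hw₂.2.trans hb)
  have e2 := hP.1 w₁ v (ha.trans hw₁.1) hw₁.2 (hv'.2.trans hb)
  have e3 : lam * dist (P w₁) (P w₂) ≤ lam * (2 * E₃) := by
    gcongr
    linarith [dist_triangle (P w₁) (η x) (P w₂), dist_comm (P w₁) (η x)]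
  linarith [dist_triangle4 (β u) (P v) (P w₁) (η x), dist_comm (P v) (P w₁),
    dist_comm (P w₁) (η x), hw₂.1]

/-- A geodesic with the same endpoints as a Morse quasi-geodesic is close to it and Morse. -/
theorem exists_gauge_of_same_endpoints {X : Type*} [MetricSpace X] (hX : GeodesicSpace X)
    (M : ℝ → ℝ → ℝ) {lam : ℝ} (hlam : 1 ≤ lam) (c : ℝ) :
    ∃ N : ℝ → ℝ → ℝ, ∀ (P η : ℝ → X) (a b a' b' : ℝ), a ≤ b → a' ≤ b' → QGOn P a b lam c →
      MorseBetween P a b M → GeodOn η a' b' → η a' = P a → η b' = P b →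
      MorseBetween η a' b' N ∧ ∀ x ∈ Icc a' b', ∃ v ∈ Icc a b, dist (η x) (P v) ≤ M 1 0 := by
  set E := max 0 (M 1 0)
  set E₃ := max E (M 7 (6 * E))
  refine ⟨fun l e => M (4 * l + 3) (e + (3 * l + 3) * E) + (2 * lam * E₃ + c + E₃),
    fun P η a b a' b' hab hab' hP hM hη hηa hηb => ?_⟩
  have hnear : ∀ x ∈ Icc a' b', ∃ v ∈ Icc a b, dist (η x) (P v) ≤ M 1 0 :=
    hM 1 0 le_rfl le_rfl η a' b' hab' hη.qgOn a b le_rfl hab le_rfl hηa hηb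
  refine ⟨fun l e hl he β p q hpq hβ s t hs hst ht hp hq u hu => ?_, hnear⟩
  have hE : 0 ≤ E := le_max_left _ _
  have hnear' : ∀ x ∈ Icc a' b', ∃ v ∈ Icc a b, dist (P v) (η x) ≤ E := fun x hx => by
    obtain ⟨v, hv, hd⟩ := hnear x hx
    exact ⟨v, hv, by rw [dist_comm]; exact hd.trans (le_max_right _ _)⟩
  obtain ⟨v₁, hv₁, hd₁⟩ := hnear' s ⟨hs, hst.trans ht⟩
  obtain ⟨v₂, hv₂, hd₂⟩ := hnear' t ⟨hs.trans hst, ht⟩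
  rcases le_total v₁ v₂ with h | h
  · exact hM.near_geodesic hX hlam hP hE le_rfl hst (hη.sub hs ht) h hv₁.1 hv₂.2 hd₁ hd₂ hl he hpq
      hβ hp hq u hu
  · obtain ⟨x, hx, hd⟩ := hM.near_geodesic hX hlam hP hE le_rfl (η := fun x => η (-x))
      (neg_le_neg hst) (hη.sub hs ht).neg h hv₂.1 hv₁.2 (by simpa using hd₂) (by simpa using hd₁)
      hl he (neg_le_neg hpq) hβ.neg (by simpa using hq) (by simpa using hp) (-u)
      ⟨neg_le_neg hu.2, neg_le_neg hu.1⟩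
    exact ⟨-x, ⟨by linarith [hx.2], by linarith [hx.1]⟩, by simpa using hd⟩

variable {X G : Type*} [MetricSpace X] [Group G] [MulAction G X] {o : X}

theorem isStableSubgroup_of_exists_path (hX : GeodesicSpace X) {H : Subgroup G}
    {M : ℝ → ℝ → ℝ} {lam c D : ℝ} (hlam : 1 ≤ lam)
    (h : ∀ h ∈ H, ∃ (P : ℝ → X) (a b : ℝ), a ≤ b ∧ QGOn P a b lam c ∧ MorseBetween P a b M ∧
      P a = o ∧ P b = h • o ∧ ∀ t ∈ Icc a b, ∃ h' ∈ H, dist (P t) (h' • o) ≤ D) :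
    IsStableSubgroup o H := by
  obtain ⟨N, hN⟩ := exists_gauge_of_same_endpoints hX M hlam c
  refine ⟨N, max 0 (M 1 0 + D), le_max_left _ _, fun h₀ hh₀ η h0 h1 hη => ?_⟩
  obtain ⟨P, a, b, hab, hP, hM, hPa, hPb, hD⟩ := h h₀ hh₀
  have hη' : GeodOn η 0 (dist o (h₀ • o)) := fun s t hs hst ht => by
    rw [hη s t ⟨hs, hst.trans ht⟩ ⟨hs.trans hst, ht⟩, abs_sub_comm, abs_of_nonneg (by linarith)]
  obtain ⟨e1, e2⟩ := hN P η a b 0 _ hab dist_nonneg hP hM hη' (by rw [h0, hPa]) (by rw [h1, hPb])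
  refine ⟨isMorseOn_iff.2 e1, fun s hs => ?_⟩
  obtain ⟨v, hv, hd⟩ := e2 s hs
  obtain ⟨h', hh', hd'⟩ := hD v hv
  exact ⟨h', hh', (dist_triangle _ _ _).trans ((add_le_add hd hd').trans (le_max_right _ _))⟩

/-- A choice of paths of length `K` from `o` to `e • o`, for all `e` moving `o` at most `K`. -/
def IsConnector (o : X) (K : ℝ) (ρ : G → ℝ → X) : Prop :=
  ∀ e : G, dist o (e • o) ≤ K → ρ e 0 = o ∧ ρ e K = e • o ∧
    ∀ s t : ℝ, 0 ≤ s → s ≤ t → t ≤ K → dist (ρ e s) (ρ e t) ≤ t - s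

theorem GeodesicSpace.exists_isConnector (hX : GeodesicSpace X) (o : X) (K : ℝ) :
    ∃ ρ : G → ℝ → X, IsConnector o K ρ := by
  choose δ h0 h1 h2 using fun e : G => hX.exists_geodOn o (e • o) 0
  simp only [zero_add] at h1 h2
  refine ⟨fun e t => δ e (min t (dist o (e • o))), fun e he => ⟨?_, ?_, fun s t hs hst ht => ?_⟩⟩
  · simp [h0]
  · simp [he, h1]
  · rw [h2 e _ _ (le_min hs dist_nonneg) (min_le_min_right _ hst) (min_le_right _ _)]
    have : min t (dist o (e • o)) ≤ min s (dist o (e • o)) + (t - s) := by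
      rw [← min_add_add_right]
      exact min_le_min (by linarith) (by linarith)
    linarith

/-- The path through the points `u k • o`, reached at the times `k * K`. -/
noncomputable def chainPath (ρ : G → ℝ → X) (K : ℝ) (u : ℕ → G) (t : ℝ) : X :=
  u ⌊t / K⌋₊ • ρ ((u ⌊t / K⌋₊)⁻¹ * u (⌊t / K⌋₊ + 1)) (t - ⌊t / K⌋₊ * K)

theorem exists_nat_mul_le {K t : ℝ} (hK : 0 < K) (ht : 0 ≤ t) :
    (⌊t / K⌋₊ : ℝ) * K ≤ t ∧ t < (⌊t / K⌋₊ + 1 : ℝ) * K :=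
  ⟨(le_div_iff₀ hK).1 (Nat.floor_le (div_nonneg ht hK.le)),
    (div_lt_iff₀ hK).1 (Nat.lt_floor_add_one _)⟩

variable {ρ : G → ℝ → X} {K : ℝ}

theorem IsConnector.chainPath_eq (hρ : IsConnector o K ρ) (hK : 0 < K) {u : ℕ → G}
    (hu : ∀ k, dist o (((u k)⁻¹ * u (k + 1)) • o) ≤ K) (k : ℕ) {t : ℝ}
    (h1 : k * K ≤ t) (h2 : t ≤ (k + 1) * K) :
    chainPath ρ K u t = u k • ρ ((u k)⁻¹ * u (k + 1)) (t - k * K) := by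
  rcases h2.eq_or_lt with rfl | h2
  · have : ⌊((k : ℝ) + 1) * K / K⌋₊ = k + 1 := by
      rw [mul_div_cancel_right₀ _ hK.ne']; exact_mod_cast Nat.floor_natCast (k + 1)
    rw [chainPath, this]
    push_cast
    rw [sub_self, (hρ _ (hu (k + 1))).1, show ((k : ℝ) + 1) * K - k * K = K by ring,
      (hρ _ (hu k)).2.1, mul_smul, smul_inv_smul]
  · have : ⌊t / K⌋₊ = k := by
      rw [Nat.floor_eq_iff (div_nonneg ((by positivity : 0 ≤ (k : ℝ) * K).trans h1) hK.le)]
      exact ⟨(le_div_iff₀ hK).2 h1, (div_lt_iff₀ hK).2 h2⟩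
    rw [chainPath, this]

theorem IsConnector.chainPath_nat_mul (hρ : IsConnector o K ρ) (hK : 0 < K) {u : ℕ → G}
    (hu : ∀ k, dist o (((u k)⁻¹ * u (k + 1)) • o) ≤ K) (k : ℕ) :
    chainPath ρ K u (k * K) = u k • o := by
  rw [hρ.chainPath_eq hK hu k le_rfl (by linarith), sub_self, (hρ _ (hu k)).1]

theorem IsConnector.chainPath_translate (hρ : IsConnector o K ρ) (hK : 0 < K) {u v : ℕ → G}
    (hu : ∀ k, dist o (((u k)⁻¹ * u (k + 1)) • o) ≤ K)
    (hv : ∀ k, dist o (((v k)⁻¹ * v (k + 1)) • o) ≤ K) {w : G} {m n W : ℕ}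
    (h : ∀ i ≤ W, u (m + i) = w * v (n + i)) {t : ℝ} (ht : 0 ≤ t) (htW : t < W * K) :
    chainPath ρ K u (m * K + t) = w • chainPath ρ K v (n * K + t) := by
  obtain ⟨h1, h2⟩ := exists_nat_mul_le hK ht
  set i := ⌊t / K⌋₊
  have hi : i < W := by
    have := h1.trans_lt htW
    exact_mod_cast lt_of_mul_lt_mul_right this hK.le
  rw [hρ.chainPath_eq hK hu (m + i) (by push_cast; linarith) (by push_cast; linarith),
    hρ.chainPath_eq hK hv (n + i) (by push_cast; linarith) (by push_cast; linarith),
    h i hi.le, add_assoc m, h (i + 1) hi, ← add_assoc n, mul_smul,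
    show (w * v (n + i))⁻¹ * (w * v (n + i + 1)) = (v (n + i))⁻¹ * v (n + i + 1) by group]
  push_cast
  ring_nf

variable [IsIsometricSMul G X]

theorem IsConnector.chainPath_dist_le (hρ : IsConnector o K ρ) (hK : 0 < K) {u : ℕ → G}
    (hu : ∀ k, dist o (((u k)⁻¹ * u (k + 1)) • o) ≤ K) {s t : ℝ} (hs : 0 ≤ s) (hst : s ≤ t) :
    dist (chainPath ρ K u s) (chainPath ρ K u t) ≤ t - s := by
  have key : ∀ k : ℕ, ∀ s t : ℝ, 0 ≤ s → s ≤ t → t ≤ k * K →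
      dist (chainPath ρ K u s) (chainPath ρ K u t) ≤ t - s := by
    intro k
    induction k with
    | zero =>
      intro s t hs hst ht
      have : s = t := by push_cast at ht; linarith
      simp [this]
    | succ k ih =>
      push_cast
      refine lipschitz_glue ih fun s t h1 h2 h3 => ?_
      rw [hρ.chainPath_eq hK hu k h1 (h2.trans h3), hρ.chainPath_eq hK hu k (h1.trans h2) h3,
        dist_smul]
      have := (hρ _ (hu k)).2.2 (s - k * K) (t - k * K) (by linarith) (by linarith) (by linarith)
      linarith
  obtain ⟨k, hk⟩ := exists_nat_gt (t / K)
  exact key k s t hs hst ((div_le_iff₀ hK).1 hk.le)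

/-- In the presence of a Morse ray, there is an infinite stable cyclic subgroup. -/
theorem exists_infinite_stable_zpowers (hX : GeodesicSpace X) (hP : ProperAction G X)
    (hC : CocompactAction G X) (hmltg : MorseLocalToGlobalSpace X)
    (hray : ∃ (γ : ℝ → X) (M : ℝ → ℝ → ℝ), IsMorseGeodesicRay γ M) (o : X) :
    ∃ f : G, (Subgroup.zpowers f : Set G).Infinite ∧
      IsStableSubgroup o (Subgroup.zpowers f) := by
  obtain ⟨R, hR, hRc⟩ := exists_coarse_surjective hC o
  obtain ⟨γ, M, hγ, hγM⟩ := hray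
  have hγd : ∀ s t : ℝ, 0 ≤ s → s ≤ t → dist (γ s) (γ t) = t - s := fun s t hs hst => by
    rw [hγ s t hs (hs.trans hst), abs_sub_comm, abs_of_nonneg (by linarith)]
  have hγM' : ∀ T, MorseBetween γ 0 T M := fun T => isMorseOn_iff.1
    fun l e hl he β L hL hβ s t hs hst _ => hγM l e hl he β L hL hβ s t hs hst
  choose g hg using fun n : ℕ => hRc (γ n)
  set K := 2 * R + 1 with hKdef
  have hK1 : 1 ≤ K := by linarith
  have hK : 0 < K := by linarith
  have hgd : ∀ n i : ℕ, dist o (((g n)⁻¹ * g (n + i)) • o) ≤ i + 2 * R := fun n i => by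
    rw [← dist_smul_smul_eq]
    have h1 := hγd n (n + i : ℕ) (Nat.cast_nonneg n)
      (by push_cast; linarith [Nat.cast_nonneg (α := ℝ) i])
    push_cast at h1
    have h2 := hg (n + i)
    push_cast at h2
    linarith [dist_triangle4 (g n • o) (γ n) (γ (n + i)) (g (n + i) • o), hg n,
      dist_comm (γ n) (g n • o)]
  have hgK : ∀ k, dist o (((g k)⁻¹ * g (k + 1)) • o) ≤ K := fun k => by
    have := hgd k 1
    push_cast at this
    linarith
  obtain ⟨ρ, hρ⟩ := hX.exists_isConnector (G := G) o K
  set P := chainPath ρ K g with hPdef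
  set E := K + R + 1 with hEdef
  have hfellow : ∀ t, 0 ≤ t → dist (P t) (γ (t / K)) ≤ E := by
    intro t ht
    obtain ⟨h1, h2⟩ := exists_nat_mul_le hK ht
    set k := ⌊t / K⌋₊
    have e1 := hρ.chainPath_dist_le hK hgK (by positivity) h1
    rw [hρ.chainPath_nat_mul hK hgK] at e1
    have e2 := hγd k (t / K) (Nat.cast_nonneg k) ((le_div_iff₀ hK).2 h1)
    have e3 : t / K < k + 1 := (div_lt_iff₀ hK).2 h2
    linarith [dist_triangle4 (P t) (g k • o) (γ k) (γ (t / K)), dist_comm (P t) (g k • o), hg k,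
      dist_comm (γ k) (g k • o)]
  have hE : 0 ≤ E := by linarith
  have hPQ : ∀ s t, 0 ≤ s → s ≤ t → QGOn P s t K (2 * E * K) := by
    refine fun a b ha hab => ⟨fun s t h1 h2 h3 => hρ.chainPath_dist_le hK hgK (ha.trans h1) h2,
      fun s t h1 h2 h3 => ?_⟩
    have e0 : s / K ≤ t / K := by gcongr
    have e1 := hγd (s / K) (t / K) (div_nonneg (ha.trans h1) hK.le) e0
    have e2 := hfellow s (ha.trans h1)
    have e3 := hfellow t (ha.trans (h1.trans h2))
    have e4 : t / K - s / K ≤ dist (P s) (P t) + 2 * E := by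
      linarith [dist_triangle4 (γ (s / K)) (P s) (P t) (γ (t / K)),
        dist_comm (γ (s / K)) (P s)]
    have e5 : t - s = K * (t / K - s / K) := by field_simp
    rw [e5]
    calc _ ≤ K * (dist (P s) (P t) + 2 * E) := by gcongr
      _ = _ := by ring
  set M₂ : ℝ → ℝ → ℝ := fun l e => M (4 * l + 3) (e + (3 * l + 3) * E) + E
  have hPM : ∀ s t, 0 ≤ s → MorseBetween P s t M₂ := fun s t hs =>
    (hγM' (t / K)).of_fellowTravel hX (fun x => x / K) (fun x y hxy => by
      simp only; gcongr) (by fun_prop) (div_nonneg hs hK.le) le_rfl hE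
      fun x hx => hfellow x (hs.trans hx.1)
  obtain ⟨M', L₀, lam, c, hL₀, hlam, hc, hglobal⟩ := hmltg M₂ K (2 * E * K) hK1 (by positivity)
  set W := ⌈L₀⌉₊ + 1 with hWdef
  have hW : L₀ + K ≤ W * K := by
    rw [hWdef]; push_cast
    nlinarith [Nat.le_ceil L₀]
  -- a repeated pattern of the sequence `g`
  obtain ⟨n, m, hnm, hpat⟩ : ∃ n m : ℕ, n < m ∧
      ∀ i ≤ W, (g n)⁻¹ * g (n + i) = (g m)⁻¹ * g (m + i) := by
    have hfin : Finite {x : G | dist o (x • o) ≤ W + 2 * R} := (hP.finite_ball o _).to_subtype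
    obtain ⟨n, m, hne, heq⟩ := Finite.exists_ne_map_eq_of_infinite
      fun n : ℕ => fun i : Fin (W + 1) =>
        (⟨(g n)⁻¹ * g (n + i), (hgd n i).trans (by
          have : (i : ℝ) ≤ W := by exact_mod_cast Nat.lt_succ_iff.1 i.2
          linarith)⟩ : {x : G | dist o (x • o) ≤ W + 2 * R})
    have heq' : ∀ i ≤ W, (g n)⁻¹ * g (n + i) = (g m)⁻¹ * g (m + i) := fun i hi =>
      congrArg Subtype.val (congrFun heq ⟨i, Nat.lt_succ_of_le hi⟩)
    rcases lt_or_gt_of_ne hne with h | h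
    · exact ⟨n, m, h, heq'⟩
    · exact ⟨m, n, h, fun i hi => (heq' i hi).symm⟩
  set p := m - n with hp
  have hp0 : 0 < p := Nat.sub_pos_of_lt hnm
  set f := (g n)⁻¹ * g m with hf
  set a : ℕ → G := fun i => (g n)⁻¹ * g (n + i) with ha
  have hap : ∀ i ≤ W, a (p + i) = f * a i := fun i hi => by
    simp only [ha, hf]
    rw [hpat i hi, ← add_assoc, show n + p = m by omega]
    group
  have hax : ∀ x, x ≤ W + p → a x = f ^ (x / p) * a (x % p) := by
    intro x
    induction x using Nat.strong_induction_on with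
    | _ x ih =>
      intro hx
      rcases lt_or_ge x p with h | h
      · simp [Nat.div_eq_of_lt h, Nat.mod_eq_of_lt h]
      · obtain ⟨i, rfl⟩ := Nat.exists_eq_add_of_le h
        rw [hap i (by omega), ih i (by omega) (by omega), Nat.add_div_left _ hp0,
          Nat.add_mod_left, pow_succ']
        exact (mul_assoc f _ _).symm
  set u : ℕ → G := fun k => f ^ (k / p) * a (k % p) with hu
  have hshift : ∀ k i, i ≤ W → u (k + i) = f ^ (k / p) * (g n)⁻¹ * g (n + k % p + i) := by
    intro k i hi
    have h1 : k + i = p * (k / p) + (k % p + i) := by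
      rw [← add_assoc, Nat.div_add_mod]
    have h2 := hax (k % p + i) (by have := Nat.mod_lt k hp0; omega)
    calc u (k + i) = u (p * (k / p) + (k % p + i)) := by rw [← h1]
      _ = f ^ (k / p) * a (k % p + i) := by
        simp only [hu]
        rw [Nat.mul_add_div hp0, Nat.mul_add_mod, pow_add, mul_assoc, ← h2]
      _ = _ := by simp only [ha]; rw [mul_assoc, add_assoc]
  have huK : ∀ k, dist o (((u k)⁻¹ * u (k + 1)) • o) ≤ K := fun k => by
    have h1 := hshift k 0 (Nat.zero_le _)
    have h2 := hshift k 1 (by omega)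
    rw [add_zero, add_zero] at h1
    have h3 : (u k)⁻¹ * u (k + 1) = (g (n + k % p))⁻¹ * g (n + k % p + 1) := by
      rw [h1, h2]; group
    rw [h3]
    exact hgK _
  set Q := chainPath ρ K u with hQ
  have hlocal : ∀ s t, 0 ≤ s → s ≤ t → t - s ≤ L₀ →
      QGOn Q s t K (2 * E * K) ∧ MorseBetween Q s t M₂ := by
    intro s t hs hst hts
    obtain ⟨h1, h2⟩ := exists_nat_mul_le hK hs
    set k := ⌊s / K⌋₊
    set d := ((n + k % p : ℕ) : ℝ) * K - k * K with hd
    have hds : 0 ≤ d + s := by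
      have : 0 ≤ ((n + k % p : ℕ) : ℝ) * K := by positivity
      linarith
    have heq : EqOn Q (fun x => (f ^ (k / p) * (g n)⁻¹) • P (d + x)) (Icc s t) := by
      intro x hx
      have := hρ.chainPath_translate hK huK hgK (hshift k) (t := x - k * K) (by linarith [hx.1])
        (by linarith [hx.2])
      rw [show (k : ℝ) * K + (x - k * K) = x by ring,
        show ((n + k % p : ℕ) : ℝ) * K + (x - k * K) = d + x by rw [hd]; ring] at this
      exact this
    exact ⟨(((hPQ (d + s) (d + t) hds (by linarith)).comp_add d le_rfl le_rfl).smul _).congr heq,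
      (((hPM (d + s) (d + t) hds).comp_add d le_rfl le_rfl).smul _).congr heq⟩
  have hQglobal : ∀ T, 0 ≤ T → QGOn Q 0 T lam c ∧ MorseBetween Q 0 T M' := fun T hT => by
    obtain ⟨h1, h2⟩ := hglobal Q T hT fun s t hs hst ht hts => by
      obtain ⟨q1, q2⟩ := hlocal s t hs hst hts
      exact ⟨isQuasiGeodesicOn_shift_iff.2 q1, isMorseOn_shift_iff.2 q2⟩
    exact ⟨h1, isMorseOn_iff.1 h2⟩
  have huj : ∀ j : ℕ, u (j * p) = f ^ j := fun j => by
    simp [hu, ha, Nat.mul_div_cancel _ hp0]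
  have hQj : ∀ j : ℕ, Q ((j * p : ℕ) * K) = f ^ j • o := fun j => by
    rw [hQ, hρ.chainPath_nat_mul hK huK, huj]
  have hQ0 : Q 0 = o := by simpa using hQj 0
  have hQnear : ∀ t, 0 ≤ t → ∃ i : ℕ, dist (Q t) (f ^ i • o) ≤ p * K := by
    intro t ht
    have hpK : 0 < (p : ℝ) * K := by positivity
    obtain ⟨h1, h2⟩ := exists_nat_mul_le hpK ht
    refine ⟨⌊t / (p * K)⌋₊, ?_⟩
    rw [← hQj, dist_comm]
    push_cast
    refine (hρ.chainPath_dist_le hK huK (by positivity) (by linarith)).trans ?_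
    linarith
  refine ⟨f, fun hfin => ?_, isStableSubgroup_of_exists_path hX (M := M') (c := c) (D := p * K)
    hlam fun h hh => ?_⟩
  · obtain ⟨B, hB⟩ := (hfin.image fun h => dist o (h • o)).bddAbove
    obtain ⟨j, hj⟩ := exists_nat_gt (lam * B + c)
    have h1 : dist o (f ^ j • o) ≤ B := hB ⟨f ^ j, Subgroup.npow_mem_zpowers f j, rfl⟩
    have hT : 0 ≤ ((j * p : ℕ) : ℝ) * K := by positivity
    have h2 := (hQglobal _ hT).1.2 0 _ le_rfl hT le_rfl
    rw [hQ0, hQj, sub_zero] at h2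
    have h3 : (j : ℝ) ≤ ((j * p : ℕ) : ℝ) * K := by
      have h4 : (j : ℝ) ≤ ((j * p : ℕ) : ℝ) := by exact_mod_cast Nat.le_mul_of_pos_right j hp0
      nlinarith [Nat.cast_nonneg (α := ℝ) j]
    have h5 : lam * dist o (f ^ j • o) ≤ lam * B := by gcongr
    linarith
  · obtain ⟨z, rfl⟩ := Subgroup.mem_zpowers_iff.1 hh
    rcases Int.eq_nat_or_neg z with ⟨j, rfl | rfl⟩
    · have hT : 0 ≤ ((j * p : ℕ) : ℝ) * K := by positivity
      refine ⟨Q, 0, _, hT, (hQglobal _ hT).1, (hQglobal _ hT).2, hQ0, by rw [hQj, zpow_natCast],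
        fun t ht => ?_⟩
      obtain ⟨i, hi⟩ := hQnear t ht.1
      exact ⟨f ^ i, Subgroup.npow_mem_zpowers f i, hi⟩
    · have hT : 0 ≤ ((j * p : ℕ) : ℝ) * K := by positivity
      refine ⟨fun t => (f ^ j)⁻¹ • Q (-t), -(((j * p : ℕ) : ℝ) * K), -0, by linarith,
        (hQglobal _ hT).1.neg.smul _, (hQglobal _ hT).2.neg.smul _,
        by simp only [neg_neg]; rw [hQj, inv_smul_smul], by simp [hQ0], fun t ht => ?_⟩
      obtain ⟨i, hi⟩ := hQnear (-t) (by linarith [ht.2])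
      refine ⟨(f ^ j)⁻¹ * f ^ i, mul_mem (inv_mem (Subgroup.npow_mem_zpowers f j))
        (Subgroup.npow_mem_zpowers f i), ?_⟩
      rw [mul_smul, dist_smul]
      exact hi

end MorseChains

/-- Growth rate gap for infinite-index stable subgroups of groups acting
geometrically on a proper geodesic Morse local-to-global space with a Morse geodesic ray. -/
theorem growth_rate_gap
    {X G : Type*} [MetricSpace X] [ProperSpace X] [Group G] [MulAction G X] (o : X)
    (hiso : IsometricAction G X) (hproper : ProperAction G X)
    (hcocompact : CocompactAction G X)
    (hgeo : GeodesicSpace X) (hmltg : MorseLocalToGlobalSpace X)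
    (hray : ∃ (γ : ℝ → X) (M : ℝ → ℝ → ℝ), IsMorseGeodesicRay γ M)
    (hnonelem : ¬ VirtuallyCyclic G)
    (H : Subgroup G) (hstable : IsStableSubgroup o H) (hinf : H.index = 0) :
    growthRate o (H : Set G) < growthRate o (Set.univ : Set G) := by
  have : IsIsometricSMul G X := ⟨fun g => Isometry.of_dist_eq (hiso g)⟩
  have hE := exists_log_ncard_le hgeo hproper hcocompact o
  by_cases hHinf : (H : Set G).Infinite
  · obtain ⟨M, D, hH⟩ := hstable.exists_stableWith
    exact hH.growthRate_lt hgeo hproper hE hmltg hinf hHinf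
  · have hHfin := Set.not_infinite.1 hHinf
    have hH0 : growthRate o (H : Set G) ≤ 0 :=
      growthRate_le le_rfl (C := (H : Set G).ncard) fun n => by
        rw [zero_mul, Real.exp_zero, mul_one]
        exact_mod_cast Set.ncard_le_ncard Set.inter_subset_left hHfin
    obtain ⟨f, hf, hfs⟩ :=
      exists_infinite_stable_zpowers hgeo hproper hcocompact hmltg hray o
    obtain ⟨M, D, hF⟩ := hfs.exists_stableWith
    have hindex : (Subgroup.zpowers f).index = 0 := by
      by_contra h
      exact hnonelem ⟨Subgroup.zpowers f, inferInstance, ⟨h⟩⟩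
    calc growthRate o (H : Set G) ≤ 0 := hH0
      _ ≤ growthRate o (Subgroup.zpowers f : Set G) := hE.growthRate_nonneg _
      _ < _ := hF.growthRate_lt hgeo hproper hE hmltg hindex hf
end

section
/- Suppose a group G acts properly by isometries on a proper geodesic metric space (X,d) and H ≤ G is a quasi-convex subgroup. Then there exists Δ ≥ 0 such that for all natural numbers n, m, the annulus 𝒜(n+m,Δ) is contained in the product set 𝒜(n,Δ)·𝒜(m,Δ); consequently #𝒜(n+m,Δ) ≤ #𝒜(n,Δ) · #𝒜(m,Δ). -/
open Metric Set Filter Pointwise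

theorem dist_smul_smul_eq_dist_inv_mul_smul {X G : Type*} [MetricSpace X] [Group G]
    [MulAction G X] (hiso : IsometricAction G X) (o : X) (g h : G) :
    dist (g • o) (h • o) = dist o ((g⁻¹ * h) • o) := by
  rw [← hiso g o ((g⁻¹ * h) • o), smul_smul, mul_inv_cancel_left]

theorem annulus_finite {X G : Type*} [MetricSpace X] [Group G] [MulAction G X] (o : X)
    (hproper : ProperAction G X) (H : Subgroup G) (n Δ : ℝ) : (annulus o H n Δ).Finite := by
  refine (hproper o (max (n + Δ) 1) (lt_max_of_lt_right one_pos)).subset ?_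
  rintro h ⟨-, hh⟩
  have hle : dist o (h • o) ≤ n + Δ := by linarith [(abs_le.1 hh).2]
  exact hle.trans (le_max_left _ _)

/-- Every element of a quasi-convex subgroup factors inside the subgroup at any prescribed
distance `s` along a geodesic, up to an error `σ`. -/
theorem exists_factor_near_geodesic {X G : Type*} [MetricSpace X] [Group G] [MulAction G X]
    {o : X} (hiso : IsometricAction G X) (hgeo : GeodesicSpace X) {H : Subgroup G} {σ : ℝ}
    (hσ : ∀ h h' : G, h ∈ H → h' ∈ H →
      ∀ γ : ℝ → X, γ 0 = h • o → γ (dist (h • o) (h' • o)) = h' • o →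
        IsGeodesicOn γ (dist (h • o) (h' • o)) →
        ∀ s ∈ Set.Icc 0 (dist (h • o) (h' • o)), ∃ h'' ∈ H, dist (γ s) (h'' • o) ≤ σ)
    {h : G} (hh : h ∈ H) {s : ℝ} (hs : s ∈ Set.Icc 0 (dist o (h • o))) :
    ∃ g ∈ H, |dist o (g • o) - s| ≤ σ ∧
      |dist o ((g⁻¹ * h) • o) - (dist o (h • o) - s)| ≤ σ := by
  obtain ⟨γ, hγ₀, hγ₁, hγ⟩ := hgeo o (h • o)
  have key := hσ 1 h H.one_mem hh γ
  simp only [one_smul] at key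
  obtain ⟨g, hg, hgs⟩ := key hγ₀ hγ₁ hγ s hs
  have hℓ : (0 : ℝ) ≤ dist o (h • o) := dist_nonneg
  have h₀ : dist o (γ s) = s := by
    have := hγ 0 s ⟨le_rfl, hℓ⟩ hs
    rwa [hγ₀, zero_sub, abs_neg, abs_of_nonneg hs.1] at this
  have h₁ : dist (γ s) (h • o) = dist o (h • o) - s := by
    have := hγ s _ hs ⟨hℓ, le_rfl⟩
    rwa [hγ₁, abs_sub_comm, abs_of_nonneg (sub_nonneg.2 hs.2)] at this
  refine ⟨g, hg, ?_, ?_⟩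
  · have := abs_dist_sub_le (g • o) (γ s) o
    rw [dist_comm _ o, dist_comm _ o, h₀] at this
    exact this.trans ((dist_comm _ _).trans_le hgs)
  · rw [← dist_smul_smul_eq_dist_inv_mul_smul hiso, ← h₁]
    exact (abs_dist_sub_le _ _ _).trans (by rwa [dist_comm])

theorem annulus_add_subset_mul {X G : Type*} [MetricSpace X] [Group G] [MulAction G X]
    {o : X} (hiso : IsometricAction G X) (hgeo : GeodesicSpace X) {H : Subgroup G} {σ : ℝ}
    (hσ : ∀ h h' : G, h ∈ H → h' ∈ H →
      ∀ γ : ℝ → X, γ 0 = h • o → γ (dist (h • o) (h' • o)) = h' • o →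
        IsGeodesicOn γ (dist (h • o) (h' • o)) →
        ∀ s ∈ Set.Icc 0 (dist (h • o) (h' • o)), ∃ h'' ∈ H, dist (γ s) (h'' • o) ≤ σ)
    {n m : ℝ} (hn : 0 ≤ n) (hm : 0 ≤ m) :
    annulus o H (n + m) (2 * σ) ⊆ annulus o H n (2 * σ) * annulus o H m (2 * σ) := by
  rintro h ⟨hh, hd⟩
  rw [abs_le] at hd
  rw [Set.mem_mul]
  by_cases hsplit : 0 ≤ dist o (h • o) - (n + m) ∨ 2 * σ < n ∧ 2 * σ < m
  · obtain ⟨g, hg, hg₁, hg₂⟩ := exists_factor_near_geodesic hiso hgeo hσ hh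
      (s := n + (dist o (h • o) - (n + m)) / 2)
      (by rcases hsplit with _ | ⟨_, _⟩ <;> constructor <;> linarith)
    rw [abs_le] at hg₁ hg₂
    refine ⟨g, ⟨hg, ?_⟩, g⁻¹ * h, ⟨H.mul_mem (H.inv_mem hg) hh, ?_⟩, mul_inv_cancel_left g h⟩ <;>
      rw [abs_le] <;> constructor <;> linarith
  · push Not at hsplit
    obtain ⟨hneg, hsmall⟩ := hsplit
    by_cases hn' : 2 * σ < n
    · have hm' := hsmall hn'
      refine ⟨h, ⟨hh, ?_⟩, 1, ⟨H.one_mem, ?_⟩, mul_one h⟩ <;>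
        rw [abs_le] <;> (try rw [one_smul, dist_self]) <;> constructor <;> linarith
    · refine ⟨1, ⟨H.one_mem, ?_⟩, h, ⟨hh, ?_⟩, one_mul h⟩ <;>
        rw [abs_le] <;> (try rw [one_smul, dist_self]) <;> constructor <;> linarith

/-- For a quasi-convex subgroup, there is `Δ ≥ 0` such that annuli are
submultiplicative: `𝒜(n+m, Δ) ⊆ 𝒜(n, Δ) · 𝒜(m, Δ)`, hence
`#𝒜(n+m, Δ) ≤ #𝒜(n, Δ) · #𝒜(m, Δ)`. -/
theorem annulus_submultiplicative
    {X G : Type*} [MetricSpace X] [ProperSpace X] [Group G] [MulAction G X] (o : X)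
    (hiso : IsometricAction G X) (hproper : ProperAction G X)
    (hgeo : GeodesicSpace X)
    (H : Subgroup G) (hqc : IsQuasiConvexSubgroup o H) :
    ∃ Δ : ℝ, 0 ≤ Δ ∧ ∀ n m : ℕ,
      annulus o H ((n : ℝ) + (m : ℝ)) Δ ⊆ annulus o H (n : ℝ) Δ * annulus o H (m : ℝ) Δ ∧
      (annulus o H ((n : ℝ) + (m : ℝ)) Δ).ncard ≤
        (annulus o H (n : ℝ) Δ).ncard * (annulus o H (m : ℝ) Δ).ncard := by
  obtain ⟨σ, hσ₀, hσ⟩ := hqc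
  refine ⟨2 * σ, by positivity, fun n m => ?_⟩
  have hsub := annulus_add_subset_mul hiso hgeo hσ (Nat.cast_nonneg n) (Nat.cast_nonneg m)
  refine ⟨hsub, (Set.ncard_le_ncard hsub ?_).trans Set.natCard_mul_le⟩
  exact (annulus_finite o hproper H _ _).mul (annulus_finite o hproper H _ _)
end

section
/- Suppose a group G acts properly by isometries on a proper geodesic metric space (X,d). Let H ≤ G be a stable subgroup and let g ∈ G be a Morse element such that for every C ≥ 0 the set {k ∈ ℤ : there exists h ∈ H with d(h·o, g^k·o) ≤ C} is finite (this is the metric formulation of Fix_{∂_M X}(g) ∩ Λ_M H = ∅). Then there exists C₁ > 0 such that for every h ∈ H, every k ∈ ℤ, and all choices of geodesics [o, h·o] and [o, g^k·o], one has diam π_{[o,g^k·o]}([o,h·o]) ≤ C₁ and diam π_{[o,h·o]}([o,g^k·o]) ≤ C₁. -/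
open Metric Set Filter Pointwise

/-- A geodesic followed by a geodesic issuing from a nearest-point projection is a
`(3, 0)`-quasi-geodesic. -/
theorem IsGeodesicOn.isQuasiGeodesicOn_concat {X : Type*} [MetricSpace X] {γ δ : ℝ → X}
    {L l t : ℝ} (hγ : IsGeodesicOn γ L) (hδ : IsGeodesicOn δ l) (ht : t ∈ Set.Icc 0 L)
    (hl : 0 ≤ l) (h0 : δ 0 = γ t) (hnear : ∀ s ∈ Set.Icc 0 L, l ≤ dist (δ l) (γ s)) :
    IsQuasiGeodesicOn (fun u => if u ≤ t then γ u else δ (u - t)) (t + l) 3 0 := by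
  obtain ⟨ht0, htL⟩ := ht
  have key : ∀ a b : ℝ, 0 ≤ a → a ≤ b → b ≤ t + l →
      dist (if a ≤ t then γ a else δ (a - t)) (if b ≤ t then γ b else δ (b - t)) ≤ b - a ∧
      b - a ≤ 3 * dist (if a ≤ t then γ a else δ (a - t))
        (if b ≤ t then γ b else δ (b - t)) := by
    intro a b ha hab hb
    by_cases hbt : b ≤ t
    · rw [if_pos hbt, if_pos (hab.trans hbt),
        hγ a b ⟨ha, by linarith⟩ ⟨by linarith, by linarith⟩, abs_sub_comm,
        abs_of_nonneg (by linarith)]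
      constructor <;> linarith
    rw [if_neg hbt]
    push Not at hbt
    by_cases hat : a ≤ t
    · rw [if_pos hat]
      have h1 : dist (γ a) (γ t) = t - a := by
        rw [hγ a t ⟨ha, by linarith⟩ ⟨ht0, htL⟩, abs_sub_comm, abs_of_nonneg (by linarith)]
      have h2 : dist (γ t) (δ (b - t)) = b - t := by
        rw [← h0, hδ 0 (b - t) ⟨le_rfl, hl⟩ ⟨by linarith, by linarith⟩, abs_sub_comm,
          abs_of_nonneg (by linarith), sub_zero]
      have h3 : dist (δ l) (δ (b - t)) = l - (b - t) := by
        rw [hδ l (b - t) ⟨hl, le_rfl⟩ ⟨by linarith, by linarith⟩, abs_of_nonneg (by linarith)]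
      have h4 := hnear a ⟨ha, by linarith⟩
      have h5 := dist_triangle (γ a) (γ t) (δ (b - t))
      have h6 := dist_triangle (δ l) (δ (b - t)) (γ a)
      have h7 := dist_triangle_right (γ a) (γ t) (δ (b - t))
      rw [dist_comm (δ (b - t)) (γ a)] at h6
      constructor <;> linarith
    · rw [if_neg hat]
      push Not at hat
      rw [hδ (a - t) (b - t) ⟨by linarith, by linarith⟩ ⟨by linarith, by linarith⟩,
        abs_sub_comm, abs_of_nonneg (by linarith)]
      constructor <;> linarith
  exact ⟨fun a b ha hab hb => (key a b ha hab hb).1,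
    fun a b ha hab hb => by simpa using (key a b ha hab hb).2⟩

/-- Projections of a Morse path to a geodesic with the same origin are close to the path. -/
theorem IsMorseOn.exists_dist_le_of_mem_projSetOf {X : Type*} [MetricSpace X]
    (hgeo : GeodesicSpace X) {γ γ' : ℝ → X} {L L' : ℝ} {M : ℝ → ℝ → ℝ}
    (hγ : IsGeodesicOn γ L) (hM : IsMorseOn γ' L' M) (h0 : γ 0 = γ' 0) {p : X}
    (hp : p ∈ projSetOf (γ '' Set.Icc 0 L) (γ' '' Set.Icc 0 L')) :
    p ∈ γ '' Set.Icc 0 L ∧ ∃ v ∈ Set.Icc 0 L', dist p (γ' v) ≤ M 3 0 := by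
  simp only [projSetOf, Set.mem_iUnion] at hp
  obtain ⟨_, ⟨b, hb, rfl⟩, ⟨t, ht, rfl⟩, hinf⟩ := hp
  refine ⟨⟨t, ht, rfl⟩, ?_⟩
  obtain ⟨δ, hδ0, hδl, hδ⟩ := hgeo (γ t) (γ' b)
  have hl : 0 ≤ dist (γ t) (γ' b) := dist_nonneg
  have hnear : ∀ s ∈ Set.Icc 0 L,
      dist (γ t) (γ' b) ≤ dist (δ (dist (γ t) (γ' b))) (γ s) := by
    intro s hs
    rw [hδl, dist_comm, hinf]
    exact Metric.infDist_le_dist_of_mem ⟨s, hs, rfl⟩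
  have hend : (if t + dist (γ t) (γ' b) ≤ t then γ (t + dist (γ t) (γ' b))
      else δ (t + dist (γ t) (γ' b) - t)) = γ' b := by
    split_ifs with h
    · have hz : dist (γ t) (γ' b) = 0 := by linarith
      rw [hz, add_zero, dist_eq_zero.mp hz]
    · rw [add_sub_cancel_left, hδl]
  obtain ⟨v, hv, hd⟩ := hM 3 0 (by norm_num) le_rfl _ _ (add_nonneg ht.1 hl)
    (hγ.isQuasiGeodesicOn_concat hδ ht hl hδ0 hnear) 0 b le_rfl hb.1 hb.2
    (by simp [ht.1, h0]) hend t ⟨ht.1, by linarith⟩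
  exact ⟨v, ⟨hv.1, hv.2.trans hb.2⟩, by simpa using hd⟩

/-- Bounded projections between geodesics `[o, h • o]` and `[o, g^k • o]`
for a stable subgroup `H` and a Morse element `g` whose powers escape every neighborhood
of `H • o`. -/
theorem bounded_projections_geodesics
    {X G : Type*} [MetricSpace X] [ProperSpace X] [Group G] [MulAction G X] (o : X)
    (hiso : IsometricAction G X) (hproper : ProperAction G X)
    (hgeo : GeodesicSpace X)
    (H : Subgroup G) (hstable : IsStableSubgroup o H)
    (g : G) (hg : IsMorseElement o g)
    (hsep : ∀ C : ℝ, 0 ≤ C → {k : ℤ | ∃ h ∈ H, dist (h • o) (g ^ k • o) ≤ C}.Finite) :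
    ∃ C₁ : ℝ, 0 < C₁ ∧ ∀ h ∈ H, ∀ k : ℤ,
      ∀ γ₁ γ₂ : ℝ → X,
        γ₁ 0 = o → γ₁ (dist o (h • o)) = h • o → IsGeodesicOn γ₁ (dist o (h • o)) →
        γ₂ 0 = o → γ₂ (dist o (g ^ k • o)) = g ^ k • o →
        IsGeodesicOn γ₂ (dist o (g ^ k • o)) →
        Metric.diam (projSetOf (γ₂ '' Set.Icc 0 (dist o (g ^ k • o)))
          (γ₁ '' Set.Icc 0 (dist o (h • o)))) ≤ C₁ ∧
        Metric.diam (projSetOf (γ₁ '' Set.Icc 0 (dist o (h • o)))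
          (γ₂ '' Set.Icc 0 (dist o (g ^ k • o)))) ≤ C₁ := by
  obtain ⟨M₁, D₁, hD₁, hH⟩ := hstable
  obtain ⟨-, M₂, D₂, hD₂, hG⟩ := hg
  set R : ℝ := max (max (M₁ 3 0) (M₂ 3 0)) 0
  have hR : 0 ≤ R := le_max_right _ _
  have hR₁ : M₁ 3 0 ≤ R := (le_max_left _ _).trans (le_max_left _ _)
  have hR₂ : M₂ 3 0 ≤ R := (le_max_right _ _).trans (le_max_left _ _)
  obtain ⟨K, hK⟩ := ((hsep (D₁ + R + D₂) (by positivity)).image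
    fun j : ℤ => dist o (g ^ j • o)).bddAbove
  have hK' : ∀ j : ℤ, ∀ h ∈ H, dist (h • o) (g ^ j • o) ≤ D₁ + R + D₂ →
      dist o (g ^ j • o) ≤ |K| := fun j h hh hd =>
    (hK ⟨j, ⟨h, hh, hd⟩, rfl⟩).trans (le_abs_self K)
  refine ⟨2 * (|K| + D₂ + R + 1), by positivity, ?_⟩
  intro h hh k γ₁ γ₂ h10 h1e h1 h20 h2e h2
  obtain ⟨hM₁, hN₁⟩ := hH h hh γ₁ h10 h1e h1
  obtain ⟨hM₂, hN₂⟩ := hG (g ^ k) (Subgroup.zpow_mem_zpowers g k) γ₂ h20 h2e h2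
  have hclose : ∀ s ∈ Set.Icc 0 (dist o (h • o)), ∀ t ∈ Set.Icc 0 (dist o (g ^ k • o)),
      dist (γ₁ s) (γ₂ t) ≤ R → dist o (γ₂ t) ≤ |K| + D₂ := by
    intro s hs t ht hst
    obtain ⟨h', hh', hd₁⟩ := hN₁ s hs
    obtain ⟨_, ⟨j, rfl⟩, hd₂⟩ := hN₂ t ht
    have hj := hK' j h' hh' (by
      have e1 := dist_triangle4 (h' • o) (γ₁ s) (γ₂ t) (g ^ j • o)
      rw [dist_comm (h' • o) (γ₁ s)] at e1
      exact e1.trans (by gcongr))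
    have e2 := dist_triangle_right o (γ₂ t) (g ^ j • o)
    exact e2.trans (by gcongr)
  have hdiam : ∀ S : Set X, (∀ p ∈ S, dist o p ≤ |K| + D₂ + R) →
      Metric.diam S ≤ 2 * (|K| + D₂ + R + 1) := by
    intro S hS
    refine Metric.diam_le_of_forall_dist_le (by positivity) fun x hx y hy => ?_
    have e := dist_triangle_left x y o
    linarith [hS x hx, hS y hy]
  refine ⟨hdiam _ fun p hp => ?_, hdiam _ fun p hp => ?_⟩
  · obtain ⟨⟨t, ht, rfl⟩, v, hv, hd⟩ :=
      hM₁.exists_dist_le_of_mem_projSetOf hgeo h2 (h20.trans h10.symm) hp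
    rw [dist_comm] at hd
    linarith [hclose v hv t ht (hd.trans hR₁)]
  · obtain ⟨⟨s, hs, rfl⟩, v, hv, hd⟩ :=
      hM₂.exists_dist_le_of_mem_projSetOf hgeo h1 (h10.trans h20.symm) hp
    have e := dist_triangle_right o (γ₁ s) (γ₂ v)
    linarith [hclose s hs v hv (hd.trans hR₂)]
end

section
/- Let X be a geodesic metric space, let σ be a geodesic segment with one endpoint o, let b ∈ X, and let a ∈ σ be a nearest point of σ to b (i.e. d(b,a) = d(b,σ)). Then the concatenation of the subsegment of σ from o to a with any geodesic [a,b] is a (3,0)-quasi-geodesic. -/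
open Metric Set Filter Pointwise

/-- The concatenation of an initial subsegment of a geodesic `σ` (from its
endpoint `o` up to a nearest point `a` of `σ` to `b`) with a geodesic `[a, b]` is a
`(3, 0)`-quasi-geodesic. -/
theorem concat_with_projection_is_quasi_geodesic
    {X : Type*} [MetricSpace X] (hgeo : GeodesicSpace X)
    (γ : ℝ → X) (L : ℝ) (hL : 0 ≤ L) (o b : X)
    (hγo : γ 0 = o) (hγ : IsGeodesicOn γ L)
    (u₀ : ℝ) (hu₀ : u₀ ∈ Set.Icc 0 L)
    (hnear : ∀ s ∈ Set.Icc 0 L, dist b (γ u₀) ≤ dist b (γ s))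
    (δ : ℝ → X) (hδ0 : δ 0 = γ u₀) (hδ1 : δ (dist (γ u₀) b) = b)
    (hδ : IsGeodesicOn δ (dist (γ u₀) b)) :
    IsQuasiGeodesicOn (fun t => if t ≤ u₀ then γ t else δ (t - u₀))
      (u₀ + dist (γ u₀) b) 3 0 := by
  set D := dist (γ u₀) b with hD
  have hD0 : 0 ≤ D := dist_nonneg
  obtain ⟨hu0, huL⟩ := hu₀
  have first : ∀ s t : ℝ, 0 ≤ s → s ≤ t → t ≤ u₀ → dist (γ s) (γ t) = t - s := by
    intro s t h0 hst ht
    rw [hγ s t ⟨h0, by linarith⟩ ⟨by linarith, by linarith⟩, abs_sub_comm,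
      abs_of_nonneg (by linarith)]
  have second : ∀ s t : ℝ, 0 ≤ s → s ≤ t → t ≤ D → dist (δ s) (δ t) = t - s := by
    intro s t h0 hst ht
    rw [hδ s t ⟨h0, by linarith⟩ ⟨by linarith, by linarith⟩, abs_sub_comm,
      abs_of_nonneg (by linarith)]
  have key : ∀ s t : ℝ, 0 ≤ s → s ≤ t → t ≤ u₀ + D →
      dist (if s ≤ u₀ then γ s else δ (s - u₀)) (if t ≤ u₀ then γ t else δ (t - u₀)) ≤ t - s ∧
      t - s ≤ 3 * dist (if s ≤ u₀ then γ s else δ (s - u₀))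
        (if t ≤ u₀ then γ t else δ (t - u₀)) := by
    intro s t h0 hst ht
    by_cases htu : t ≤ u₀
    · rw [if_pos (hst.trans htu), if_pos htu, first s t h0 hst htu]
      constructor <;> linarith
    · rw [if_neg htu]
      push Not at htu
      by_cases hsu : s ≤ u₀
      · rw [if_pos hsu]
        have h1 := first s u₀ h0 hsu le_rfl
        have h2 := second 0 (t - u₀) le_rfl (by linarith) (by linarith)
        have h3 := second (t - u₀) D (by linarith) (by linarith) le_rfl
        rw [hδ0] at h2
        rw [hδ1] at h3
        have h4 := hnear s ⟨h0, by linarith⟩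
        rw [dist_comm b, dist_comm b, ← hD] at h4
        have h5 := dist_triangle (γ s) (δ (t - u₀)) b
        have h6 := dist_triangle (γ s) (γ u₀) (δ (t - u₀))
        have h7 := dist_triangle_right (γ s) (γ u₀) (δ (t - u₀))
        constructor <;> linarith
      · rw [if_neg hsu]
        push Not at hsu
        rw [second (s - u₀) (t - u₀) (by linarith) (by linarith) (by linarith)]
        constructor <;> linarith
  exact ⟨fun s t h0 hst ht => (key s t h0 hst ht).1,
    fun s t h0 hst ht => by rw [add_zero]; exact (key s t h0 hst ht).2⟩
end
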